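/- Let F be a codimension one singular holomorphic foliation on ℙ^3 with locally free tangent sheaf, and assume F is tangent to a nontrivial (i.e. not identically zero) global holomorphic vector field on ℙ^3. Then the tangent sheaf T_F splits, i.e. T_F ≅ O_{ℙ^3}(a) ⊕ O_{ℙ^3}(b) for some integers a, b. -/

import Mathlib

open Topology Filter Set
open scoped ENNReal Manifold

noncomputable section

/-- `ℂⁿ`. -/
abbrev Cn (n : ℕ) : Type := Fin n → ℂ

/-- Holomorphic `m`-forms on (open subsets of) `ℂⁿ`, as alternating-map valued functions. -/
abbrev Form (n m : ℕ) : Type := Cn n → AlternatingMap ℂ (Cn n) ℂ (Fin m)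

/-- Vector fields on (open subsets of) `ℂⁿ`. -/
abbrev VF (n : ℕ) : Type := Cn n → Cn n

/-- A form is holomorphic on `U` if all its coefficient functions are. -/
def HolFormOn {n m : ℕ} (U : Set (Cn n)) (ω : Form n m) : Prop :=
  ∀ v : Fin m → Cn n, AnalyticOnNhd ℂ (fun z => ω z v) U

/-- A form is holomorphic at (a neighborhood of) a point `c`. -/
def HolFormAt {n m : ℕ} (c : Cn n) (ω : Form n m) : Prop :=
  ∀ v : Fin m → Cn n, AnalyticAt ℂ (fun z => ω z v) c

/-- The zero locus (singular set) of a form. -/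
def zeroLocus {n m : ℕ} (ω : Form n m) : Set (Cn n) := {z | ω z = 0}

/-- `V ⊆ ℂⁿ` has (complex) codimension at least `c`; via Hausdorff dimension
(a complex-analytic set of complex dimension `d` has Hausdorff dimension `2d`).
The empty set has codimension `≥ c` for every `c`. -/
def CodimGE (n : ℕ) (V : Set (Cn n)) (c : ℕ) : Prop :=
  V = ∅ ∨ dimH V + 2 * (c : ℝ≥0∞) ≤ 2 * (n : ℝ≥0∞)

/-- The germ of `V` at `c` has codimension at least `k`. -/
def GermCodimGE (n : ℕ) (c : Cn n) (V : Set (Cn n)) (k : ℕ) : Prop :=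
  ∃ U ∈ 𝓝 c, CodimGE n (V ∩ U) k

/-- `i_X (ω) = 0` at the point `z` : the form `ω` annihilates the vector `X z` at `z`. -/
def TangentAt {n m : ℕ} (ω : Form n m) (X : VF n) (z : Cn n) : Prop :=
  ∀ (v : Fin m → Cn n) (i : Fin m), v i = X z → ω z v = 0

/-- `ω` is locally decomposable (as a wedge of holomorphic `1`-forms) at the points
of `U` where it does not vanish. -/
def LocallyDecomp {n m : ℕ} (U : Set (Cn n)) (ω : Form n m) : Prop :=
  ∀ z ∈ U, ω z ≠ 0 → ∃ W ∈ 𝓝 z, W ⊆ U ∧ ∃ η : Fin m → Cn n → (Cn n →ₗ[ℂ] ℂ),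
    (∀ i (v : Cn n), AnalyticOnNhd ℂ (fun w => η i w v) W) ∧
    ∀ w ∈ W, ∀ v : Fin m → Cn n, ω w v = Matrix.det (Matrix.of fun i j => η i w (v j))

/-- The rank of the derivative (linear part) of a vector field at a point. -/
def rkAt {n : ℕ} (X : VF n) (z : Cn n) : ℕ :=
  Module.finrank ℂ (LinearMap.range (fderiv ℂ X z).toLinearMap)

/-- The germ at `c` of the vector field `X` divides the germ of the `m`-form `ω`:
`ω = i_X Θ` for some germ of holomorphic `(m+1)`-form `Θ`. -/
def DividesAt {n m : ℕ} (X : VF n) (ω : Form n m) (c : Cn n) : Prop :=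
  ∃ Θ : Form n (m + 1), HolFormAt c Θ ∧
    ∀ᶠ z in 𝓝 c, ∀ v : Fin m → Cn n, ω z v = Θ z (Fin.cons (X z) v)

/-- The germ at `0` of an `m`-form defines a singular holomorphic distribution:
it is holomorphic, locally decomposable outside its zero set, and its zero set has
codimension at least two. -/
structure IsGermDist (n m : ℕ) (ω : Form n m) : Prop where
  hol : ∃ U ∈ 𝓝 (0 : Cn n), HolFormOn U ω ∧ LocallyDecomp U ω
  codim : GermCodimGE n 0 (zeroLocus ω) 2

/-- The tangent sheaf of the germ of two-dimensional distribution defined by the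
`m`-form `ω` (`m = n - 2`) is locally free: `ω = i_Y i_Z Θ` for germs of vector fields
`Y, Z` and a germ of `n`-form `Θ`. -/
def GermLocFree2 (n m : ℕ) (ω : Form n m) : Prop :=
  ∃ (Y Z : VF n) (Θ : Form n (m + 2)), AnalyticAt ℂ Y 0 ∧ AnalyticAt ℂ Z 0 ∧ HolFormAt 0 Θ ∧
    ∀ᶠ z in 𝓝 (0 : Cn n), ∀ v : Fin m → Cn n,
      ω z v = Θ z (Fin.cons (Y z) (Fin.cons (Z z) v))

/-- `ω = i_X i_Y Θ` near `0`, for some germ of vector field `Y` and germ of `n`-form `Θ`. -/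
def DivPairAt {n m : ℕ} (X : VF n) (ω : Form n m) : Prop :=
  ∃ (Y : VF n) (Θ : Form n (m + 2)), AnalyticAt ℂ Y 0 ∧ HolFormAt 0 Θ ∧
    ∀ᶠ z in 𝓝 (0 : Cn n), ∀ v : Fin m → Cn n,
      ω z v = Θ z (Fin.cons (X z) (Fin.cons (Y z) v))

/-- The tangent sheaf of the germ of `k`-dimensional distribution defined by the `m`-form
`ω` (`n = k + m`) is locally free: `ω = i_{X_1} ⋯ i_{X_k} Θ`. -/
def GermLocFreeK (n k m : ℕ) (h : n = k + m) (ω : Form n m) : Prop :=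
  ∃ (Xs : Fin k → VF n) (Θ : Form n n), (∀ i, AnalyticAt ℂ (Xs i) 0) ∧ HolFormAt 0 Θ ∧
    ∀ᶠ z in 𝓝 (0 : Cn n), ∀ v : Fin m → Cn n,
      ω z v = Θ z (fun i => Fin.append (fun a => Xs a z) v (Fin.cast h i))

/-- The germs at `c` of the vector fields `Xs` freely generate the germs of vector
fields tangent to the distribution defined by `ω` : every germ of tangent vector field
is a combination of the `Xs` with holomorphic coefficients, and the coefficients in such
combinations are unique (i.e. the `Xs` are independent over the local ring at `c`). -/
def FreeGensAt {n m : ℕ} (ω : Form n m) {k : ℕ} (Xs : Fin k → VF n) (c : Cn n) : Prop :=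
  (∀ Z : VF n, AnalyticAt ℂ Z c → (∀ᶠ z in 𝓝 c, TangentAt ω Z z) →
      ∃ f : Fin k → Cn n → ℂ, (∀ i, AnalyticAt ℂ (f i) c) ∧
        ∀ᶠ z in 𝓝 c, Z z = ∑ i, f i z • Xs i z) ∧
  (∀ f : Fin k → Cn n → ℂ, (∀ i, AnalyticAt ℂ (f i) c) →
      (∀ᶠ z in 𝓝 c, (∑ i, f i z • Xs i z) = 0) → ∀ i, ∀ᶠ z in 𝓝 c, f i z = 0)

/-- Polydiscs in `ℂⁿ`. -/
def IsPolydisc {n : ℕ} (U : Set (Cn n)) : Prop :=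
  ∃ (c : Cn n) (r : Fin n → ℝ), (∀ i, 0 < r i) ∧ U = {z | ∀ i, dist (z i) (c i) < r i}

/-- The wedge product of a `1`-form with a `k`-form, as a function of `k+1` vectors. -/
def wedge1 {n k : ℕ} (ω : Form n 1) (α : Form n k) (z : Cn n) (v : Fin (k + 1) → Cn n) : ℂ :=
  ∑ i : Fin (k + 1), (-1 : ℂ) ^ (i : ℕ) * ω z (fun _ => v i) * α z (fun j => v (i.succAbove j))

/-! ### Analytic subsets of open sets of `ℂᴺ`, irreducibility, components -/

/-- `V` is an analytic subset of `U`: locally (on `U`) it is the common zero set of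
finitely many holomorphic functions. -/
def IsAnalyticIn {N : ℕ} (U V : Set (Cn N)) : Prop :=
  V ⊆ U ∧ ∀ p ∈ U, ∃ W ∈ 𝓝 p, ∃ (r : ℕ) (f : Fin r → Cn N → ℂ),
    (∀ i, AnalyticOnNhd ℂ (f i) W) ∧ ∀ z ∈ W ∩ U, (z ∈ V ↔ ∀ i, f i z = 0)

/-- An irreducible analytic subset of `U`. -/
def IsIrredAnalyticIn {N : ℕ} (U V : Set (Cn N)) : Prop :=
  IsAnalyticIn U V ∧ V.Nonempty ∧
    ∀ V1 V2, IsAnalyticIn U V1 → IsAnalyticIn U V2 → V = V1 ∪ V2 → V = V1 ∨ V = V2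

/-- `C` is an irreducible component of the analytic set `V ⊆ U` : a maximal irreducible
analytic subset of `U` contained in `V`. -/
def IsIrredComponentIn {N : ℕ} (U V C : Set (Cn N)) : Prop :=
  IsIrredAnalyticIn U C ∧ C ⊆ V ∧ ∀ C', IsIrredAnalyticIn U C' → C ⊆ C' → C' ⊆ V → C' = C

/-! ### Distributions and foliations on `ℙⁿ`, in homogeneous coordinates -/

/-- A `k`-dimensional singular holomorphic distribution of degree `d` on `ℙⁿ`, given in
homogeneous coordinates by a homogeneous `(n-k)`-form `ω` on `ℂⁿ⁺¹` (with polynomial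
coefficients of degree `d+1`) satisfying `i_R ω = 0`, locally decomposable outside its
singular set, whose singular set has codimension at least `2`. -/
structure ProjDist (n k : ℕ) where
  d : ℕ
  ω : Form (n + 1) (n - k)
  hol : HolFormOn Set.univ ω
  homog : ∀ (t : ℂ) (z : Cn (n + 1)) (v : Fin (n - k) → Cn (n + 1)),
    ω (t • z) v = t ^ (d + 1) * ω z v
  radial : ∀ (z : Cn (n + 1)) (v : Fin (n - k) → Cn (n + 1)) (i : Fin (n - k)),
    v i = z → ω z v = 0
  decomp : LocallyDecomp Set.univ ω
  codim : CodimGE (n + 1) {z | z ≠ 0 ∧ ω z = 0} 2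

/-- The singular set of a distribution on `ℙⁿ`, as a cone in `ℂⁿ⁺¹ \ {0}`. -/
def ProjDist.coneSing {n k : ℕ} (D : ProjDist n k) : Set (Cn (n + 1)) :=
  {z | z ≠ 0 ∧ D.ω z = 0}

/-- A one-dimensional singular holomorphic foliation of degree `d` on `ℙⁿ`, given in
homogeneous coordinates by a homogeneous polynomial vector field on `ℂⁿ⁺¹`, whose
singular set (points where `V ∧ R = 0`) has codimension at least `2`. -/
structure ProjFol1 (n : ℕ) where
  d : ℕ
  V : VF (n + 1)
  hol : AnalyticOnNhd ℂ V Set.univ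
  homog : ∀ (t : ℂ) (z : Cn (n + 1)), V (t • z) = t ^ d • V z
  codim : CodimGE (n + 1) {z | z ≠ 0 ∧ V z ∈ Submodule.span ℂ {z}} 2

/-- The singular set of a one-dimensional foliation on `ℙⁿ`, as a cone in `ℂⁿ⁺¹ \ {0}`. -/
def ProjFol1.coneSing {n : ℕ} (G : ProjFol1 n) : Set (Cn (n + 1)) :=
  {z | z ≠ 0 ∧ G.V z ∈ Submodule.span ℂ {z}}

/-- The foliation `G` is tangent to the distribution `D` : `i_V ω = 0`. -/
def PTangent {n k : ℕ} (G : ProjFol1 n) (D : ProjDist n k) : Prop :=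
  ∀ (z : Cn (n + 1)) (v : Fin (n - k) → Cn (n + 1)) (i : Fin (n - k)),
    v i = G.V z → D.ω z v = 0

/-- `G` locally divides the two-dimensional distribution `D` at the point of `ℙⁿ`
corresponding to `q ∈ ℂⁿ⁺¹ \ {0}` : in homogeneous coordinates, `ω = i_V i_R Θ` near `q`
for some germ of holomorphic `(n-1)`-form `Θ` (equivalently, in an affine chart at `[q]`,
the defining vector field of `G` divides the defining form of `D`). -/
def PLocDividesAt {n : ℕ} (G : ProjFol1 n) (D : ProjDist n 2) (q : Cn (n + 1)) : Prop :=
  ∃ Θ : Form (n + 1) (n - 2 + 2), HolFormAt q Θ ∧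
    ∀ᶠ z in 𝓝 q, ∀ v : Fin (n - 2) → Cn (n + 1),
      D.ω z v = Θ z (Fin.cons (G.V z) (Fin.cons z v))

/-- The tangent sheaf of the two-dimensional distribution `D` on `ℙⁿ` is locally free:
near every point of `ℂⁿ⁺¹ \ {0}` one can write `ω = i_X i_Y i_R Θ`. -/
def PLocFreeAt {n : ℕ} (D : ProjDist n 2) (q : Cn (n + 1)) : Prop :=
  ∃ (X Y : VF (n + 1)) (Θ : Form (n + 1) (n - 2 + 3)),
    AnalyticAt ℂ X q ∧ AnalyticAt ℂ Y q ∧ HolFormAt q Θ ∧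
    ∀ᶠ z in 𝓝 q, ∀ v : Fin (n - 2) → Cn (n + 1),
      D.ω z v = Θ z (Fin.cons (X z) (Fin.cons (Y z) (Fin.cons z v)))

def PLocFree {n : ℕ} (D : ProjDist n 2) : Prop :=
  ∀ q : Cn (n + 1), q ≠ 0 → PLocFreeAt D q

/-- The linearization, at a singular point `q` (with `ℓ q = 1`), of the vector field
induced on the affine chart `{ℓ = 1}` of `ℙⁿ` by the homogeneous vector field `V`. -/
def projLin {n : ℕ} (V : VF n) (q : Cn n) (ℓ : Cn n →ₗ[ℂ] ℂ) : Cn n →ₗ[ℂ] Cn n :=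
  (fderiv ℂ V q).toLinearMap - LinearMap.smulRight (ℓ ∘ₗ (fderiv ℂ V q).toLinearMap) q
    - ℓ (V q) • LinearMap.id

/-- The linear rank of the one-dimensional foliation `G` on `ℙⁿ` is at least `r` :
at every singular point, the linearization of the vector field induced on an affine
chart has rank at least `r`. -/
def PLinRankGE {n : ℕ} (G : ProjFol1 n) (r : ℕ) : Prop :=
  ∀ q ∈ G.coneSing, ∃ ℓ : Cn (n + 1) →ₗ[ℂ] ℂ, ℓ q = 1 ∧
    r ≤ Module.finrank ℂ (Submodule.map (projLin G.V q ℓ) (LinearMap.ker ℓ))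

/-- `T_D = T_G ⊕ T_H` : in homogeneous coordinates,
`ω = c ⋅ i_{V_G} i_{V_H} i_R (dx_0 ∧ ⋯ ∧ dx_n)` for a nonzero constant `c`. -/
def SplitPair {n : ℕ} (hn : n + 1 = 3 + (n - 2)) (G H : ProjFol1 n) (D : ProjDist n 2) :
    Prop :=
  ∃ c : ℂ, c ≠ 0 ∧ ∀ (z : Cn (n + 1)) (v : Fin (n - 2) → Cn (n + 1)),
    D.ω z v = c * Matrix.det (Matrix.of fun i j =>
      Fin.append ![G.V z, H.V z, z] v (Fin.cast hn i) j)

/-- The tangent sheaf of the two-dimensional distribution `D` on `ℙⁿ` splits as a direct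
sum of two line bundles: `ω = c ⋅ i_{X_1} i_{X_2} i_R (dx_0 ∧ ⋯ ∧ dx_n)` for homogeneous
polynomial vector fields `X_1, X_2` on `ℂⁿ⁺¹`. -/
def PSplits {n : ℕ} (hn : n + 1 = 3 + (n - 2)) (D : ProjDist n 2) : Prop :=
  ∃ (X1 X2 : VF (n + 1)) (d1 d2 : ℕ) (c : ℂ), c ≠ 0 ∧
    AnalyticOnNhd ℂ X1 Set.univ ∧ AnalyticOnNhd ℂ X2 Set.univ ∧
    (∀ (t : ℂ) (z : Cn (n + 1)), X1 (t • z) = t ^ d1 • X1 z) ∧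
    (∀ (t : ℂ) (z : Cn (n + 1)), X2 (t • z) = t ^ d2 • X2 z) ∧
    ∀ (z : Cn (n + 1)) (v : Fin (n - 2) → Cn (n + 1)),
      D.ω z v = c * Matrix.det (Matrix.of fun i j =>
        Fin.append ![X1 z, X2 z, z] v (Fin.cast hn i) j)

/-- The coefficient of the exterior differential of a `1`-form: `dω(a,b)` at `z`. -/
def extd1 {N : ℕ} (ω : Form N 1) (z a b : Cn N) : ℂ :=
  fderiv ℂ (fun y => ω y ![b]) z a - fderiv ℂ (fun y => ω y ![a]) z b

/-- The Frobenius integrability condition `ω ∧ dω = 0` for a `1`-form. -/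
def Integrable1 {N : ℕ} (ω : Form N 1) : Prop :=
  ∀ z a b c : Cn N,
    ω z ![a] * extd1 ω z b c + ω z ![b] * extd1 ω z c a + ω z ![c] * extd1 ω z a b = 0

/-! ### Distributions and foliations on complex manifolds -/

section Manifold

variable {n k : ℕ} {M : Type*} [TopologicalSpace M] [ChartedSpace (Cn n) M]

/-- A `k`-dimensional singular holomorphic distribution on a complex `n`-manifold `M`:
around each point it is given, in the chart at that point, by a holomorphic `(n-k)`-form,
locally decomposable outside its zero set, with zero set of codimension at least 2;
on overlaps the local forms agree up to a nonvanishing holomorphic factor. -/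
structure MDist (n k : ℕ) (M : Type*) [TopologicalSpace M] [ChartedSpace (Cn n) M] where
  ω : M → Form n (n - k)
  dom : M → Set (Cn n)
  dom_open : ∀ p, IsOpen (dom p)
  dom_sub : ∀ p, dom p ⊆ (chartAt (Cn n) p).target
  dom_mem : ∀ p, chartAt (Cn n) p p ∈ dom p
  hol : ∀ p, HolFormOn (dom p) (ω p)
  decomp : ∀ p, LocallyDecomp (dom p) (ω p)
  codim : ∀ p, CodimGE n (zeroLocus (ω p) ∩ dom p) 2
  compat : ∀ p q : M, ∀ x : M, x ∈ (chartAt (Cn n) p).source → x ∈ (chartAt (Cn n) q).source →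
    chartAt (Cn n) p x ∈ dom p → chartAt (Cn n) q x ∈ dom q →
    ∃ W ∈ 𝓝 (chartAt (Cn n) p x), W ⊆ dom p ∧
      ∃ h : Cn n → ℂ, AnalyticOnNhd ℂ h W ∧ (∀ z ∈ W, h z ≠ 0) ∧
      ∀ z ∈ W, ∀ v : Fin (n - k) → Cn n,
        ω p z v = h z * ω q ((chartAt (Cn n) q) ((chartAt (Cn n) p).symm z))
          (fun i => fderiv ℂ (fun y => (chartAt (Cn n) q) ((chartAt (Cn n) p).symm y)) z (v i))

/-- The singular set of a distribution on a manifold. -/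
def MDist.sing (D : MDist n k M) : Set M :=
  {x | D.ω x (chartAt (Cn n) x x) = 0}

/-- A one-dimensional singular holomorphic foliation on a complex `n`-manifold `M`:
around each point it is given, in the chart at that point, by a holomorphic vector field
with singular set of codimension at least 2; on overlaps the local vector fields agree,
up to a nonvanishing holomorphic factor, under the differentials of the transition maps. -/
structure MFol1 (n : ℕ) (M : Type*) [TopologicalSpace M] [ChartedSpace (Cn n) M] where
  V : M → VF n
  dom : M → Set (Cn n)
  dom_open : ∀ p, IsOpen (dom p)
  dom_sub : ∀ p, dom p ⊆ (chartAt (Cn n) p).target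
  dom_mem : ∀ p, chartAt (Cn n) p p ∈ dom p
  hol : ∀ p, AnalyticOnNhd ℂ (V p) (dom p)
  codim : ∀ p, CodimGE n ({z ∈ dom p | V p z = 0}) 2
  compat : ∀ p q : M, ∀ x : M, x ∈ (chartAt (Cn n) p).source → x ∈ (chartAt (Cn n) q).source →
    chartAt (Cn n) p x ∈ dom p → chartAt (Cn n) q x ∈ dom q →
    ∃ W ∈ 𝓝 (chartAt (Cn n) p x), W ⊆ dom p ∧
      ∃ h : Cn n → ℂ, AnalyticOnNhd ℂ h W ∧ (∀ z ∈ W, h z ≠ 0) ∧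
      ∀ z ∈ W,
        fderiv ℂ (fun y => (chartAt (Cn n) q) ((chartAt (Cn n) p).symm y)) z (V p z)
          = h z • V q ((chartAt (Cn n) q) ((chartAt (Cn n) p).symm z))

/-- The singular set of a one-dimensional foliation on a manifold. -/
def MFol1.sing (G : MFol1 n M) : Set M :=
  {x | G.V x (chartAt (Cn n) x x) = 0}

/-- The foliation `G` is tangent to the distribution `D`. -/
def MTangent (G : MFol1 n M) (D : MDist n k M) : Prop :=
  ∀ p : M, ∀ z ∈ G.dom p ∩ D.dom p, TangentAt (D.ω p) (G.V p) z

/-- `G` locally divides `D` at `p` : in the chart at `p`, the germ of the defining vector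
field of `G` divides the germ of the defining form of `D`. -/
def MLocDividesAt (G : MFol1 n M) (D : MDist n k M) (p : M) : Prop :=
  DividesAt (G.V p) (D.ω p) (chartAt (Cn n) p p)

/-- The linear rank of `G` is at least `r`: at every singular point `p`, the rank of the
derivative at (the chart image of) `p` of the defining vector field is at least `r`. -/
def MLinRankGE (G : MFol1 n M) (r : ℕ) : Prop :=
  ∀ p ∈ MFol1.sing G, r ≤ rkAt (G.V p) (chartAt (Cn n) p p)

/-- The stalk of the tangent sheaf of `D` at `p` is a free module with `r` generators. -/
def MStalkFreeWith (D : MDist n k M) (p : M) (r : ℕ) : Prop :=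
  ∃ Xs : Fin r → VF n, (∀ i, AnalyticAt ℂ (Xs i) (chartAt (Cn n) p p)) ∧
    (∀ i, ∀ᶠ z in 𝓝 (chartAt (Cn n) p p), TangentAt (D.ω p) (Xs i) z) ∧
    FreeGensAt (D.ω p) Xs (chartAt (Cn n) p p)

/-- (a) The tangent sheaf of `D` is locally free of rank `k`: near every point there are
`k` holomorphic tangent vector fields which freely generate every stalk. -/
def MPropA (D : MDist n k M) : Prop :=
  ∀ p : M, ∃ U : Set (Cn n), IsOpen U ∧ chartAt (Cn n) p p ∈ U ∧ U ⊆ D.dom p ∧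
    ∃ Xs : Fin k → VF n, (∀ i, AnalyticOnNhd ℂ (Xs i) U) ∧
      (∀ i, ∀ z ∈ U, TangentAt (D.ω p) (Xs i) z) ∧
      ∀ z ∈ U, FreeGensAt (D.ω p) Xs z

/-- (b) Near every point, `T_D` is the direct sum of the tangent sheaves of `k`
one-dimensional foliations (defined by vector fields with singular set of codim `≥ 2`). -/
def MPropB (D : MDist n k M) : Prop :=
  ∀ p : M, ∃ U : Set (Cn n), IsOpen U ∧ chartAt (Cn n) p p ∈ U ∧ U ⊆ D.dom p ∧
    ∃ Xs : Fin k → VF n, (∀ i, AnalyticOnNhd ℂ (Xs i) U) ∧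
      (∀ i, CodimGE n {z ∈ U | Xs i z = 0} 2) ∧
      (∀ i, ∀ z ∈ U, TangentAt (D.ω p) (Xs i) z) ∧
      ∀ z ∈ U, FreeGensAt (D.ω p) Xs z

/-- (c) Near every point, a form `i_{X_1} ⋯ i_{X_k} Θ` defines `D`. -/
def MPropC (h : n = k + (n - k)) (D : MDist n k M) : Prop :=
  ∀ p : M, ∃ U : Set (Cn n), IsOpen U ∧ chartAt (Cn n) p p ∈ U ∧ U ⊆ D.dom p ∧
    ∃ (Xs : Fin k → VF n) (Θ : Form n n) (u : Cn n → ℂ),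
      (∀ i, AnalyticOnNhd ℂ (Xs i) U) ∧ HolFormOn U Θ ∧
      AnalyticOnNhd ℂ u U ∧ (∀ z ∈ U, u z ≠ 0) ∧
      ∀ z ∈ U, ∀ v : Fin (n - k) → Cn n,
        D.ω p z v = u z * Θ z (fun i => Fin.append (fun a => Xs a z) v (Fin.cast h i))

/-- (d) At every point, a form `i_{X_1} ⋯ i_{X_k} Θ` defines the germ of `D`. -/
def MPropD (h : n = k + (n - k)) (D : MDist n k M) : Prop :=
  ∀ p : M, ∃ (Xs : Fin k → VF n) (Θ : Form n n) (u : Cn n → ℂ),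
    (∀ i, AnalyticAt ℂ (Xs i) (chartAt (Cn n) p p)) ∧ HolFormAt (chartAt (Cn n) p p) Θ ∧
    AnalyticAt ℂ u (chartAt (Cn n) p p) ∧ u (chartAt (Cn n) p p) ≠ 0 ∧
    ∀ᶠ z in 𝓝 (chartAt (Cn n) p p), ∀ v : Fin (n - k) → Cn n,
      D.ω p z v = u z * Θ z (fun i => Fin.append (fun a => Xs a z) v (Fin.cast h i))

/-- (e) Every stalk of `T_D` is a free module with `k` generators. -/
def MPropE (D : MDist n k M) : Prop :=
  ∀ p : M, MStalkFreeWith D p k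

/-- A subset `S` of the complex manifold `M` is analytic: it is closed and locally,
in charts, the common zero set of finitely many holomorphic functions. -/
def MIsAnalytic (n : ℕ) {M : Type*} [TopologicalSpace M] [ChartedSpace (Cn n) M] (S : Set M) : Prop :=
  IsClosed S ∧ ∀ p : M, ∃ W ∈ 𝓝 (chartAt (Cn n) p p), ∃ (r : ℕ) (f : Fin r → Cn n → ℂ),
    (∀ i, AnalyticOnNhd ℂ (f i) W) ∧
    ∀ z ∈ W ∩ (chartAt (Cn n) p).target, ((chartAt (Cn n) p).symm z ∈ S ↔ ∀ i, f i z = 0)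

/-- Irreducible analytic subsets of `M`. -/
def MIrredAnalytic (n : ℕ) {M : Type*} [TopologicalSpace M] [ChartedSpace (Cn n) M] (S : Set M) : Prop :=
  MIsAnalytic n S ∧ S.Nonempty ∧
    ∀ S1 S2 : Set M, MIsAnalytic n S1 → MIsAnalytic n S2 → S = S1 ∪ S2 → S = S1 ∨ S = S2

/-- `C` is an irreducible component of `V ⊆ M`. -/
def MIrredComponentOf (n : ℕ) {M : Type*} [TopologicalSpace M] [ChartedSpace (Cn n) M] (V C : Set M) : Prop :=
  MIrredAnalytic n C ∧ C ⊆ V ∧ ∀ C', MIrredAnalytic n C' → C ⊆ C' → C' ⊆ V → C' = C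

/-- The local dimension of `S ⊆ M` at `p` equals `d` (via Hausdorff dimension of chart
images on small neighborhoods). -/
def MLocDimEq (n : ℕ) {M : Type*} [TopologicalSpace M] [ChartedSpace (Cn n) M] (S : Set M) (p : M) (d : ℕ) : Prop :=
  ∀ᶠ U in (𝓝 p).smallSets,
    dimH (chartAt (Cn n) p '' (S ∩ U ∩ (chartAt (Cn n) p).source)) = ((2 * d : ℕ) : ℝ≥0∞)

/-- The dimension of `S ⊆ M` equals `d`. -/
def MDimEq (n : ℕ) {M : Type*} [TopologicalSpace M] [ChartedSpace (Cn n) M] (S : Set M) (d : ℕ) : Prop :=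
  (∀ p : M, ∀ᶠ U in (𝓝 p).smallSets,
    dimH (chartAt (Cn n) p '' (S ∩ U ∩ (chartAt (Cn n) p).source)) ≤ ((2 * d : ℕ) : ℝ≥0∞)) ∧
  ∃ p : M, MLocDimEq n S p d

end Manifold

end


/-- Parametric integrals along a curve are `C¹`. -/
theorem contDiff_param {E : Type*} [NormedAddCommGroup E] [NormedSpace ℂ E] [FiniteDimensional ℂ E]
    (φ : E → ℂ) (U : Set E) (hU : IsOpen U) (hφ : AnalyticOnNhd ℂ φ U) (c : ℝ → E)
    (hc : Continuous c) (q : E) (T : ℝ) (hK : ∀ θ ∈ Set.uIcc 0 T, q + c θ ∈ U) :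
    ContDiffAt ℂ 1 (fun z => ∫ θ in (0:ℝ)..T, φ (z + c θ)) q := by
  have : ProperSpace E := FiniteDimensional.proper ℂ E
  have hKc : IsCompact ((fun θ => q + c θ) '' Set.uIcc 0 T) :=
    isCompact_uIcc.image (by fun_prop)
  obtain ⟨δ, hδ, hsub⟩ := hKc.exists_cthickening_subset_open hU (by
    rintro _ ⟨θ, hθ, rfl⟩; exact hK θ hθ)
  have hCc : IsCompact (Metric.cthickening δ ((fun θ => q + c θ) '' Set.uIcc 0 T)) :=
    hKc.cthickening
  have hmem : ∀ z ∈ Metric.ball q δ, ∀ θ ∈ Set.uIcc 0 T,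
      z + c θ ∈ Metric.cthickening δ ((fun θ => q + c θ) '' Set.uIcc 0 T) := by
    intro z hz θ hθ
    apply Metric.mem_cthickening_of_dist_le (z + c θ) (q + c θ) δ _ (Set.mem_image_of_mem (fun θ => q + c θ) hθ)
    simpa using (Metric.mem_ball.1 hz).le
  have hfd : ContinuousOn (fderiv ℂ φ) U := hφ.fderiv.continuousOn
  obtain ⟨M, hM⟩ := hCc.exists_bound_of_continuousOn (hfd.mono hsub)
  have hcont : ∀ z ∈ Metric.ball q δ, ContinuousOn (fun θ => φ (z + c θ)) (Set.uIcc 0 T) := by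
    intro z hz
    exact hφ.continuousOn.comp (by fun_prop) (fun θ hθ => hsub (hmem z hz θ hθ))
  have hcont' : ∀ z ∈ Metric.ball q δ,
      ContinuousOn (fun θ => fderiv ℂ φ (z + c θ)) (Set.uIcc 0 T) := by
    intro z hz
    exact hfd.comp (by fun_prop) (fun θ hθ => hsub (hmem z hz θ hθ))
  rw [contDiffAt_one_iff]
  refine ⟨fun z => ∫ θ in (0:ℝ)..T, fderiv ℂ φ (z + c θ), Metric.ball q δ,
    Metric.ball_mem_nhds q hδ, ?_, ?_⟩
  · intro z hz
    apply ContinuousAt.continuousWithinAt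
    have hnb : Metric.ball q δ ∈ 𝓝 z := Metric.isOpen_ball.mem_nhds hz
    apply intervalIntegral.continuousAt_of_dominated_interval (bound := fun _ => M)
    · filter_upwards [hnb] with x hx
      exact ((hcont' x hx).mono Set.uIoc_subset_uIcc).aestronglyMeasurable measurableSet_uIoc
    · filter_upwards [hnb] with x hx
      exact Filter.Eventually.of_forall fun θ hθ => hM _ (hmem x hx θ (Set.uIoc_subset_uIcc hθ))
    · exact intervalIntegrable_const
    · refine Filter.Eventually.of_forall fun θ hθ => ?_
      have h1 : ContinuousAt (fderiv ℂ φ) (z + c θ) :=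
        hfd.continuousAt (hU.mem_nhds (hsub (hmem z hz θ (Set.uIoc_subset_uIcc hθ))))
      exact ContinuousAt.comp (f := fun x => x + c θ) h1 (by fun_prop)
  · intro z hz
    have hnb : Metric.ball q δ ∈ 𝓝 z := Metric.isOpen_ball.mem_nhds hz
    apply intervalIntegral.hasFDerivAt_integral_of_dominated_of_fderiv_le
      (F' := fun x θ => fderiv ℂ φ (x + c θ)) (bound := fun _ => M) hnb
    · filter_upwards [hnb] with x hx
      exact ((hcont x hx).mono Set.uIoc_subset_uIcc).aestronglyMeasurable measurableSet_uIoc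
    · exact (hcont z hz).intervalIntegrable
    · exact ((hcont' z hz).mono Set.uIoc_subset_uIcc).aestronglyMeasurable measurableSet_uIoc
    · exact Filter.Eventually.of_forall fun θ hθ x hx => hM _ (hmem x hx θ (Set.uIoc_subset_uIcc hθ))
    · exact intervalIntegrable_const
    · refine Filter.Eventually.of_forall fun θ hθ x hx => ?_
      have h1 := (hφ _ (hsub (hmem x hx θ (Set.uIoc_subset_uIcc hθ)))).differentiableAt.hasFDerivAt
      have h2 : HasFDerivAt (fun x => x + c θ) (ContinuousLinearMap.id ℂ E) x :=
        (hasFDerivAt_id x).add_const _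
      exact h1.comp x h2

/-- Lines in a fixed direction avoiding a small set are dense. -/
theorem dense_lines (Sg : Set (Fin 4 → ℂ)) (hdim : dimH Sg < 6) (u : Fin 4 → ℂ) (hu : u ≠ 0) :
    Dense {z : Fin 4 → ℂ | ∀ t : ℂ, z + t • u ∉ Sg} := by
  let K := Submodule.span ℂ {u}
  have hcl : IsClosed (K : Set (Fin 4 → ℂ)) := K.closed_of_finiteDimensional
  let π : (Fin 4 → ℂ) →L[ℂ] ((Fin 4 → ℂ) ⧸ K) := K.mkQL
  have hfr : Module.finrank ℝ ((Fin 4 → ℂ) ⧸ K) = 6 := by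
    rw [finrank_real_of_complex]
    have h1 := K.finrank_quotient_add_finrank
    have h2 : Module.finrank ℂ K = 1 := finrank_span_singleton hu
    rw [h2] at h1
    simp at h1
    omega
  have hd : Dense (π '' Sg)ᶜ := by
    have : FiniteDimensional ℝ ((Fin 4 → ℂ) ⧸ K) := FiniteDimensional.complexToReal _
    apply dense_compl_of_dimH_lt_finrank
    rw [hfr]
    exact lt_of_le_of_lt (π.lipschitz.dimH_image_le Sg) (by exact_mod_cast hdim)
  have hop : IsOpenMap π := K.isOpenMap_mkQ
  refine (hd.preimage hop).mono ?_
  intro z hz t ht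
  apply hz
  refine ⟨z + t • u, ht, ?_⟩
  change K.mkQ (z + t • u) = K.mkQ z
  have : K.mkQ u = 0 := by
    rw [Submodule.mkQ_apply, Submodule.Quotient.mk_eq_zero]
    exact Submodule.mem_span_singleton_self u
  rw [map_add, map_smul, this, smul_zero, add_zero]

/-- Hartogs type division. -/
theorem hartogs_div {ι : Type*} (a N : ι → (Fin 4 → ℂ) → ℂ) (q : Fin 4 → ℂ) (U : Set (Fin 4 → ℂ))
    (hU : U ∈ 𝓝 q) (ha : ∀ i, AnalyticOnNhd ℂ (a i) univ)
    (hdim : dimH {z | ∀ i, a i z = 0} < 6) (hN : ∀ i, AnalyticOnNhd ℂ (N i) U)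
    (hrel : ∀ z ∈ U, ∀ i j, N i z * a j z = N j z * a i z) :
    ∃ h : (Fin 4 → ℂ) → ℂ, ContDiffAt ℂ 1 h q ∧ ∀ᶠ z in 𝓝 q, ∀ i, N i z = h z * a i z := by
  obtain ⟨p, i0, hp⟩ : ∃ p i, a i p ≠ 0 := by
    by_contra hcon
    push Not at hcon
    have : {z | ∀ i, a i z = 0} = univ := by ext z; simpa using fun i => hcon z i
    rw [this, Real.dimH_univ_eq_finrank, finrank_real_of_complex] at hdim
    simp at hdim
    norm_num at hdim
  obtain ⟨u, hu, t0, ht0⟩ : ∃ u : Fin 4 → ℂ, u ≠ 0 ∧ ∃ t : ℂ, a i0 (q + t • u) ≠ 0 := by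
    by_cases hpq : p = q
    · exact ⟨fun _ => 1, fun h => by simpa using congrFun h 0, 0, by simpa [← hpq] using hp⟩
    · exact ⟨p - q, sub_ne_zero.2 hpq, 1, by simpa using hp⟩
  have hlin : AnalyticOnNhd ℂ (fun t : ℂ => a i0 (q + t • u)) univ := by
    intro t _
    exact (ha i0 _ (mem_univ _)).comp_of_eq (f := fun t : ℂ => q + t • u) (by fun_prop) rfl
  have hiso : ∀ᶠ t in 𝓝[≠] (0:ℂ), a i0 (q + t • u) ≠ 0 := by
    rcases (hlin 0 (mem_univ _)).eventually_eq_zero_or_eventually_ne_zero with h | h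
    · exfalso
      have := hlin.eq_of_eventuallyEq (g := fun _ => 0) analyticOnNhd_const h
      exact ht0 (congrFun this t0)
    · exact h
  rw [eventually_nhdsWithin_iff, Metric.eventually_nhds_iff] at hiso
  obtain ⟨r0, hr0, hiso⟩ := hiso
  obtain ⟨ε, hε, hεU⟩ := Metric.mem_nhds_iff.1 hU
  have hun : 0 < ‖u‖ := norm_pos_iff.2 hu
  set r := min r0 (ε / ‖u‖) / 2 with hr
  have hrpos : 0 < r := by positivity
  have hrr0 : r < r0 := by
    have := min_le_left r0 (ε / ‖u‖); linarith
  have hru : r * ‖u‖ ≤ ε / 2 := by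
    have h1 := min_le_right r0 (ε / ‖u‖)
    have h2 : r ≤ (ε / ‖u‖) / 2 := by rw [hr]; linarith
    calc r * ‖u‖ ≤ (ε / ‖u‖) / 2 * ‖u‖ := by gcongr
      _ = ε / 2 := by field_simp
  let U' : Set (Fin 4 → ℂ) := Metric.ball q ε ∩ {z | a i0 z ≠ 0}
  have hU'o : IsOpen U' :=
    Metric.isOpen_ball.inter (isOpen_ne_fun (continuousOn_univ.1 (ha i0).continuousOn) continuous_const)
  have hφ : AnalyticOnNhd ℂ (fun z => N i0 z / a i0 z) U' := by
    intro z hz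
    exact (hN i0 z (hεU hz.1)).div (ha i0 z (mem_univ _)) hz.2
  have hball : ∀ z ∈ Metric.ball q (ε/2), ∀ t : ℂ, ‖t‖ ≤ r → z + t • u ∈ Metric.ball q ε := by
    intro z hz t ht
    rw [mem_ball_iff_norm] at hz ⊢
    calc ‖z + t • u - q‖ = ‖(z - q) + t • u‖ := by congr 1; abel
      _ ≤ ‖z - q‖ + ‖t • u‖ := norm_add_le _ _
      _ = ‖z - q‖ + ‖t‖ * ‖u‖ := by rw [norm_smul]
      _ ≤ ‖z - q‖ + r * ‖u‖ := by gcongr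
      _ < ε := by linarith
  have hqb : q ∈ Metric.ball q (ε/2) := Metric.mem_ball_self (by positivity)
  have hcirc : ∀ θ, q + circleMap 0 r θ • u ∈ U' := by
    intro θ
    have hn : ‖circleMap 0 r θ‖ = r := by simp [abs_of_pos hrpos]
    refine ⟨hball q hqb _ hn.le, ?_⟩
    apply hiso
    · simpa [hn] using hrr0
    · intro h0
      rw [mem_singleton_iff] at h0
      rw [h0, norm_zero] at hn
      exact hrpos.ne hn
  have hev : ∀ᶠ z in 𝓝 q, ∀ θ ∈ Set.uIcc (0:ℝ) (2 * Real.pi), z + circleMap 0 r θ • u ∈ U' := by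
    apply IsCompact.eventually_forall_of_forall_eventually isCompact_uIcc
    intro θ _
    have hc : Continuous (fun w : (Fin 4 → ℂ) × ℝ => w.1 + circleMap 0 r w.2 • u) := by
      have := continuous_circleMap 0 r
      fun_prop
    exact hc.continuousAt.eventually (hU'o.mem_nhds (hcirc θ))
  obtain ⟨h, hh⟩ : ∃ h : (Fin 4 → ℂ) → ℂ, h = fun z => (2 * Real.pi)⁻¹ •
    ∫ θ in (0:ℝ)..(2 * Real.pi), (fun z => N i0 z / a i0 z) (z + circleMap 0 r θ • u) := ⟨_, rfl⟩
  have hC1 : ContDiffAt ℂ 1 h q := by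
    rw [hh]
    apply ContDiffAt.const_smul
    exact contDiff_param _ U' hU'o hφ (fun θ => circleMap 0 r θ • u)
      ((continuous_circleMap 0 r).smul continuous_const) q _ (fun θ _ => hcirc θ)
  refine ⟨h, hC1, ?_⟩
  have hD := dense_lines _ hdim u hu
  -- the formula on good lines
  have hgood : ∀ z ∈ Metric.ball q (ε/2),
      (∀ θ ∈ Set.uIcc (0:ℝ) (2 * Real.pi), z + circleMap 0 r θ • u ∈ U') →
      (∀ t : ℂ, z + t • u ∉ {z | ∀ i, a i z = 0}) → ∀ i, N i z = h z * a i z := by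
    intro z hz hzc hzl
    have hch : ∀ t : ℂ, ∃ i, a i (z + t • u) ≠ 0 := by
      intro t; simpa using hzl t
    choose J hJ using hch
    let k : ℂ → ℂ := fun t => N (J t) (z + t • u) / a (J t) (z + t • u)
    have hk : ∀ t : ℂ, ‖t‖ ≤ r → ∀ i, a i (z + t • u) ≠ 0 →
        k t = N i (z + t • u) / a i (z + t • u) := by
      intro t ht i hi
      rw [div_eq_div_iff (hJ t) hi]
      exact hrel _ (hεU (hball z hz t ht)) _ _
    have hJa : ∀ i, ∀ t : ℂ, AnalyticAt ℂ (fun t : ℂ => a i (z + t • u)) t := fun i t =>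
      (ha i _ (mem_univ _)).comp_of_eq (f := fun t : ℂ => z + t • u) (by fun_prop) rfl
    have hkc : ∀ t ∈ Metric.closedBall (0:ℂ) |r|, ∃ f : ℂ → ℂ, DifferentiableAt ℂ f t ∧
        f t = k t ∧ ∀ᶠ s in 𝓝 t, ‖s‖ ≤ r → k s = f s := by
      intro t ht
      have htr : ‖t‖ ≤ r := by simpa [abs_of_pos hrpos] using ht
      refine ⟨fun s => N (J t) (z + s • u) / a (J t) (z + s • u), ?_, rfl, ?_⟩
      · have h1 : AnalyticAt ℂ (fun s : ℂ => N (J t) (z + s • u)) t :=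
          (hN (J t) _ (hεU (hball z hz t htr))).comp_of_eq (f := fun t : ℂ => z + t • u)
            (by fun_prop) rfl
        exact (h1.div (hJa (J t) t) (hJ t)).differentiableAt
      · filter_upwards [(hJa (J t) t).continuousAt.eventually_ne (hJ t)] with s hs hsr
        exact hk s hsr _ hs
    have havg : Real.circleAverage k 0 r = k 0 := by
      apply circleAverage_of_differentiable_on_off_countable countable_empty
      · intro t ht
        obtain ⟨f, hf, hft, hfe⟩ := hkc t ht
        refine hf.continuousAt.continuousWithinAt.congr_of_eventuallyEq ?_ hft.symm
        filter_upwards [nhdsWithin_le_nhds hfe, self_mem_nhdsWithin] with s hs hsm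
        exact hs (by simpa [abs_of_pos hrpos] using hsm)
      · intro t ht
        obtain ⟨f, hf, hft, hfe⟩ := hkc t (Metric.ball_subset_closedBall ht.1)
        refine hf.congr_of_eventuallyEq ?_
        filter_upwards [hfe, Metric.isOpen_ball.mem_nhds ht.1] with s hs hsm
        apply hs
        have : ‖s‖ < |r| := by simpa using hsm
        rw [abs_of_pos hrpos] at this
        exact this.le
    have hhz : h z = k 0 := by
      rw [← havg, hh, Real.circleAverage_def]
      refine congrArg (fun x : ℂ => (2 * Real.pi)⁻¹ • x) ?_
      apply intervalIntegral.integral_congr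
      intro θ hθ
      exact (hk _ (by simp [abs_of_pos hrpos]) i0 (hzc θ hθ).2).symm
    intro i
    have h0 := hJ 0
    have hrel0 := hrel z (hεU (by simpa using hball z hz 0 (by simpa using hrpos.le))) i (J 0)
    rw [hhz]
    simp only [k, zero_smul, add_zero] at h0 ⊢
    field_simp
    linear_combination hrel0
  have hcev : ∀ᶠ z in 𝓝 q, ContDiffAt ℂ 1 h z := hC1.eventually (by simp)
  obtain ⟨B, hBsub, hBo, hqB⟩ := eventually_nhds_iff.1
    ((hcev.and hev).and (Metric.ball_mem_nhds q (half_pos hε)))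
  filter_upwards [hBo.mem_nhds hqB] with z hz i
  by_contra hne
  have hcont : ContinuousOn (fun z => N i z - h z * a i z) B := by
    intro w hw
    have h1 := (hN i w (hεU (by simpa using hball w (hBsub w hw).2 0 (by simpa using hrpos.le)))).continuousAt
    have h2 := (hBsub w hw).1.1.continuousAt
    have h3 := (ha i w (mem_univ _)).continuousAt
    exact (h1.sub (h2.mul h3)).continuousWithinAt
  have hopn := hcont.isOpen_inter_preimage hBo (t := {0}ᶜ) isOpen_compl_singleton
  obtain ⟨w, ⟨hwB, hw0⟩, hwD⟩ := hD.inter_open_nonempty _ hopn ⟨z, hz, by simpa [sub_eq_zero] using hne⟩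
  apply hw0
  have := hgood w (hBsub w hwB).2 (hBsub w hwB).1.2 hwD i
  simp [this]


/-- The ambient space. -/
abbrev V4 : Type := Fin 4 → ℂ

/-- Entire functions homogeneous of degree `k`. -/
structure Hg (k : ℕ) (f : V4 → ℂ) : Prop where
  an : AnalyticOnNhd ℂ f univ
  hom : ∀ (t : ℂ) (z : V4), f (t • z) = t ^ k * f z

theorem Hg.cont {k : ℕ} {f : V4 → ℂ} (h : Hg k f) : Continuous f := by
  rw [← continuousOn_univ]
  exact h.an.continuousOn

theorem Hg.diff {k : ℕ} {f : V4 → ℂ} (h : Hg k f) (z : V4) : DifferentiableAt ℂ f z :=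
  (h.an z (mem_univ z)).differentiableAt

theorem Hg.zero (k : ℕ) : Hg k (fun _ => 0) := ⟨analyticOnNhd_const, by simp⟩

theorem Hg.const (c : ℂ) : Hg 0 (fun _ => c) := ⟨analyticOnNhd_const, by simp⟩

theorem Hg.add {k : ℕ} {f g : V4 → ℂ} (hf : Hg k f) (hg : Hg k g) :
    Hg k (fun z => f z + g z) :=
  ⟨hf.an.add hg.an, fun t z => by rw [hf.hom, hg.hom]; ring⟩

theorem Hg.cmul {k : ℕ} {f : V4 → ℂ} (c : ℂ) (hf : Hg k f) :
    Hg k (fun z => c * f z) :=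
  ⟨analyticOnNhd_const.mul hf.an, fun t z => by rw [hf.hom]; ring⟩

theorem Hg.neg {k : ℕ} {f : V4 → ℂ} (hf : Hg k f) : Hg k (fun z => - f z) :=
  ⟨hf.an.neg, fun t z => by rw [hf.hom]; ring⟩

theorem Hg.sub {k : ℕ} {f g : V4 → ℂ} (hf : Hg k f) (hg : Hg k g) :
    Hg k (fun z => f z - g z) :=
  ⟨hf.an.sub hg.an, fun t z => by rw [hf.hom, hg.hom]; ring⟩

theorem lin_an {F : Type*} [NormedAddCommGroup F] [NormedSpace ℂ F] (l : V4 →ₗ[ℂ] F) :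
    AnalyticOnNhd ℂ (fun z => l z) univ := fun z _ =>
  (LinearMap.toContinuousLinearMap l).analyticAt z

theorem Hg.lmul {k : ℕ} {f : V4 → ℂ} (l : V4 →ₗ[ℂ] ℂ) (hf : Hg k f) :
    Hg (k + 1) (fun z => l z * f z) :=
  ⟨(lin_an l).mul hf.an, fun t z => by rw [hf.hom, map_smul, smul_eq_mul]; ring⟩

theorem Hg.xmul {k : ℕ} {f : V4 → ℂ} (i : Fin 4) (hf : Hg k f) :
    Hg (k + 1) (fun z => z i * f z) := hf.lmul (LinearMap.proj i)

theorem Hg.sum {k : ℕ} {ι : Type*} (s : Finset ι) {f : ι → V4 → ℂ} (hf : ∀ i, Hg k (f i)) :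
    Hg k (fun z => ∑ i ∈ s, f i z) := by
  classical
  induction s using Finset.induction_on with
  | empty => simpa using Hg.zero k
  | insert a s ha ih =>
    simp only [Finset.sum_insert ha]
    exact (hf a).add ih

theorem Hg.comp {k : ℕ} {f : V4 → ℂ} (A : V4 →ₗ[ℂ] V4) (hf : Hg k f) :
    Hg k (fun z => f (A z)) :=
  ⟨fun z _ => (hf.an (A z) (mem_univ _)).comp_of_eq (lin_an A z (mem_univ _)) rfl,
    fun t z => by rw [map_smul, hf.hom]⟩

/-- Continuous functions of one complex variable which agree off `0` agree. -/
theorem eq_of_ne_zero {F : Type*} [TopologicalSpace F] [T2Space F] {f g : ℂ → F}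
    (hf : ContinuousAt f 0) (hg : ContinuousAt g 0)
    (h : ∀ᶠ t in 𝓝[≠] (0:ℂ), f t = g t) : f 0 = g 0 := by
  have h1 : Tendsto f (𝓝[≠] 0) (𝓝 (f 0)) := hf.tendsto.mono_left nhdsWithin_le_nhds
  have h2 : Tendsto g (𝓝[≠] 0) (𝓝 (g 0)) := hg.tendsto.mono_left nhdsWithin_le_nhds
  exact tendsto_nhds_unique_of_eventuallyEq h1 h2 h

/-- Cancellation of a linear form. -/
theorem cancel_lin {f g : V4 → ℂ} (hf : Continuous f) (hg : Continuous g) (l : V4 →ₗ[ℂ] ℂ)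
    (u : V4) (hu : l u ≠ 0) (h : ∀ z, l z * f z = l z * g z) (z : V4) : f z = g z := by
  by_cases hz : l z = 0
  · have := eq_of_ne_zero (f := fun t : ℂ => f (z + t • u)) (g := fun t : ℂ => g (z + t • u))
      (by fun_prop) (by fun_prop) (by
        filter_upwards [self_mem_nhdsWithin] with t ht
        have h1 := h (z + t • u)
        have h2 : l (z + t • u) ≠ 0 := by
          rw [map_add, map_smul, hz, zero_add, smul_eq_mul]
          exact mul_ne_zero ht hu
        exact mul_left_cancel₀ h2 h1)
    simpa using this
  · exact mul_left_cancel₀ hz (h z)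

/-- Same cancellation along the kernel of another form. -/
theorem cancel_lin_on {f g : V4 → ℂ} (hf : Continuous f) (hg : Continuous g) (l m : V4 →ₗ[ℂ] ℂ)
    (u : V4) (hu : l u ≠ 0) (hmu : m u = 0) (h : ∀ z, m z = 0 → l z * f z = l z * g z)
    (z : V4) (hmz : m z = 0) : f z = g z := by
  by_cases hz : l z = 0
  · have := eq_of_ne_zero (f := fun t : ℂ => f (z + t • u)) (g := fun t : ℂ => g (z + t • u))
      (by fun_prop) (by fun_prop) (by
        filter_upwards [self_mem_nhdsWithin] with t ht
        have h1 := h (z + t • u) (by simp [hmz, hmu])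
        have h2 : l (z + t • u) ≠ 0 := by
          rw [map_add, map_smul, hz, zero_add, smul_eq_mul]
          exact mul_ne_zero ht hu
        exact mul_left_cancel₀ h2 h1)
    simpa using this
  · exact mul_left_cancel₀ hz (h z hmz)

theorem Hg.fderiv_an {k : ℕ} {f : V4 → ℂ} (hf : Hg k f) (a : V4) :
    AnalyticOnNhd ℂ (fun z => fderiv ℂ f z a) univ := fun z hz =>
  (ContinuousLinearMap.apply ℂ ℂ a).analyticAt _ |>.comp_of_eq (hf.an.fderiv z hz) rfl

/-- Partial derivatives of homogeneous functions. -/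
theorem Hg.fderiv {k : ℕ} {f : V4 → ℂ} (hf : Hg (k + 1) f) (a : V4) :
    Hg k (fun z => fderiv ℂ f z a) := by
  refine ⟨hf.fderiv_an a, ?_⟩
  have hc : Continuous (fun z => _root_.fderiv ℂ f z a) := by
    rw [← continuousOn_univ]; exact (hf.fderiv_an a).continuousOn
  have key : ∀ (t : ℂ), t ≠ 0 → ∀ z, _root_.fderiv ℂ f (t • z) a = t ^ k * _root_.fderiv ℂ f z a := by
    intro t ht z
    have h1 : HasFDerivAt (fun z => f (t • z)) ((_root_.fderiv ℂ f (t • z)).comp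
        (t • ContinuousLinearMap.id ℂ V4)) z :=
      (hf.diff (t • z)).hasFDerivAt.comp z ((hasFDerivAt_id z).const_smul t)
    have h2 : HasFDerivAt (fun z => f (t • z)) (t ^ (k + 1) • _root_.fderiv ℂ f z) z := by
      have := (hf.diff z).hasFDerivAt.const_mul (t ^ (k + 1))
      exact this.congr_of_eventuallyEq (Eventually.of_forall fun z => hf.hom t z)
    have h3 := congrArg (fun L : V4 →L[ℂ] ℂ => L a) (h1.unique h2)
    simp at h3
    apply mul_left_cancel₀ ht
    rw [h3]; ring
  intro t z
  by_cases ht : t = 0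
  · subst ht
    exact eq_of_ne_zero (f := fun t : ℂ => _root_.fderiv ℂ f (t • z) a)
      (g := fun t : ℂ => t ^ k * _root_.fderiv ℂ f z a) (by fun_prop) (by fun_prop) (by
        filter_upwards [self_mem_nhdsWithin] with t ht
        exact key t ht z)
  · exact key t ht z

/-- Euler's identity. -/
theorem Hg.euler {k : ℕ} {f : V4 → ℂ} (hf : Hg k f) (z : V4) :
    _root_.fderiv ℂ f z z = k * f z := by
  have h1 : HasDerivAt (fun t : ℂ => f (t • z)) (_root_.fderiv ℂ f ((1:ℂ) • z) z) 1 := by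
    have h0 : HasDerivAt (fun t : ℂ => t • z) z 1 := by
      simpa using (hasDerivAt_id (1:ℂ)).smul_const z
    exact (hf.diff ((1:ℂ) • z)).hasFDerivAt.comp_hasDerivAt (1:ℂ) h0
  have h2 : HasDerivAt (fun t : ℂ => f (t • z)) (k * f z) 1 := by
    have := (hasDerivAt_pow k (1:ℂ)).mul_const (f z)
    simp only [one_pow, mul_one] at this
    exact this.congr_of_eventuallyEq (Eventually.of_forall fun t => hf.hom t z)
  have := h1.unique h2
  simpa using this

theorem Hg.const_of_zero {f : V4 → ℂ} (hf : Hg 0 f) (z : V4) : f z = f 0 := by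
  have := hf.hom 0 z
  simpa using this.symm

/-- the standard basis -/
noncomputable abbrev ee (i : Fin 4) : V4 := Pi.single i 1

theorem sum_ee (z : V4) : z = ∑ i, z i • ee i := by
  ext j
  simp [Finset.sum_apply, Pi.single_apply]

/-- Euler decomposition. -/
theorem Hg.decomp {k : ℕ} {f : V4 → ℂ} (hf : Hg (k + 1) f) :
    ∃ F : Fin 4 → V4 → ℂ, (∀ i, Hg k (F i)) ∧ ∀ z, f z = ∑ i, z i * F i z := by
  refine ⟨fun i z => ((k:ℂ) + 1)⁻¹ * _root_.fderiv ℂ f z (ee i), fun i => (hf.fderiv (ee i)).cmul _, ?_⟩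
  intro z
  have h1 := hf.euler z
  have h2 : _root_.fderiv ℂ f z z = ∑ i, z i * _root_.fderiv ℂ f z (ee i) := by
    conv_lhs => rw [show (_root_.fderiv ℂ f z) z = (_root_.fderiv ℂ f z) (∑ i, z i • ee i) by
      rw [← sum_ee z]]
    rw [map_sum]
    simp only [map_smul, smul_eq_mul]
  have hk : (k:ℂ) + 1 ≠ 0 := by exact_mod_cast Nat.succ_ne_zero k
  have h3 : ∑ i, z i * (((k:ℂ) + 1)⁻¹ * _root_.fderiv ℂ f z (ee i))
      = ((k:ℂ) + 1)⁻¹ * ∑ i, z i * _root_.fderiv ℂ f z (ee i) := by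
    rw [Finset.mul_sum]; exact Finset.sum_congr rfl fun i _ => by ring
  rw [h3, ← h2, h1]
  push_cast
  field_simp

/-- Division by a linear form with remainder. -/
theorem Hg.div1 {k : ℕ} {f : V4 → ℂ} (hf : Hg (k + 1) f) (l : V4 →ₗ[ℂ] ℂ) (u : V4) :
    ∃ g, Hg k g ∧ ∀ z, f z - f (z - l z • u) = l z * g z := by
  induction k generalizing f with
  | zero =>
    obtain ⟨F, hF, hfF⟩ := hf.decomp
    refine ⟨fun z => ∑ i, u i * F i z, Hg.sum _ fun i => (hF i).cmul _, ?_⟩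
    intro z
    rw [hfF, hfF, ← Finset.sum_sub_distrib, Finset.mul_sum]
    refine Finset.sum_congr rfl fun i _ => ?_
    rw [(hF i).const_of_zero z, (hF i).const_of_zero (z - _)]
    simp only [Pi.sub_apply, Pi.smul_apply, smul_eq_mul]
    ring
  | succ k ih =>
    obtain ⟨F, hF, hfF⟩ := hf.decomp
    choose g hg hgF using fun i => ih (hF i)
    refine ⟨fun z => ∑ i, (u i * F i z + ((LinearMap.proj i : V4 →ₗ[ℂ] ℂ) - u i • l) z * g i z),
      Hg.sum _ fun i => ((hF i).cmul _).add ((hg i).lmul _), ?_⟩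
    intro z
    rw [hfF, hfF, ← Finset.sum_sub_distrib, Finset.mul_sum]
    refine Finset.sum_congr rfl fun i _ => ?_
    have := hgF i z
    simp only [Pi.sub_apply, Pi.smul_apply, smul_eq_mul, LinearMap.sub_apply, LinearMap.smul_apply,
      LinearMap.proj_apply]
    linear_combination (z i - u i * l z) * this

/-- A form vanishing on `l1 = l2 = 0` lies in the ideal `(l1, l2)`. -/
theorem Hg.div2 {k : ℕ} {f : V4 → ℂ} (hf : Hg (k + 1) f) (l1 l2 : V4 →ₗ[ℂ] ℂ) (u1 u2 : V4)
    (h11 : l1 u1 = 1) (h12 : l1 u2 = 0) (h21 : l2 u1 = 0) (h22 : l2 u2 = 1)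
    (hv : ∀ z, l1 z = 0 → l2 z = 0 → f z = 0) :
    ∃ a b, Hg k a ∧ Hg k b ∧ ∀ z, f z = l1 z * a z + l2 z * b z := by
  obtain ⟨a, ha, hfa⟩ := hf.div1 l1 u1
  let A : V4 →ₗ[ℂ] V4 := LinearMap.id - l1.smulRight u1
  obtain ⟨b, hb, hfb⟩ := (hf.comp A).div1 l2 u2
  refine ⟨a, b, ha, hb, fun z => ?_⟩
  have h1 := hfa z
  have h2 := hfb z
  have h3 : f (A (z - l2 z • u2)) = 0 := by
    apply hv <;> simp [A, h11, h12, h21, h22]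
  rw [h3] at h2
  have h4 : A z = z - l1 z • u1 := by simp [A]
  rw [h4] at h2
  linear_combination h1 + h2

/-- Syzygies of two independent linear forms. -/
theorem Hg.syz {k : ℕ} {a b : V4 → ℂ} (ha : Hg (k + 1) a) (hb : Hg (k + 1) b)
    (l1 l2 : V4 →ₗ[ℂ] ℂ) (u1 u2 : V4)
    (h11 : l1 u1 = 1) (h21 : l2 u1 = 0) (h22 : l2 u2 = 1)
    (h : ∀ z, l1 z * a z + l2 z * b z = 0) :
    ∃ c, Hg k c ∧ (∀ z, a z = l2 z * c z) ∧ ∀ z, b z = - (l1 z * c z) := by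
  have hav : ∀ z, l2 z = 0 → a z = 0 := fun z hz =>
    cancel_lin_on (g := fun _ => 0) ha.cont continuous_const l1 l2 u1 (by simp [h11]) h21
      (fun z hz => by have := h z; rw [hz] at this; linear_combination this) z hz
  obtain ⟨c, hc, hac⟩ := ha.div1 l2 u2
  have hac' : ∀ z, a z = l2 z * c z := by
    intro z
    rw [← hac z, hav (z - l2 z • u2) (by simp [h22]), sub_zero]
  refine ⟨c, hc, hac', ?_⟩
  apply cancel_lin hb.cont (hc.lmul l1).neg.cont l2 u2 (by simp [h22])
  intro z
  have := h z
  rw [hac' z] at this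
  linear_combination this

/-- Degree zero syzygies vanish. -/
theorem Hg.syz0 {a b : V4 → ℂ} (ha : Hg 0 a) (hb : Hg 0 b)
    (l1 l2 : V4 →ₗ[ℂ] ℂ) (u1 u2 : V4)
    (h11 : l1 u1 = 1) (h21 : l2 u1 = 0) (h22 : l2 u2 = 1)
    (h : ∀ z, l1 z * a z + l2 z * b z = 0) (z : V4) : a z = 0 ∧ b z = 0 := by
  have h1 := h u1
  have h2 := h u2
  rw [h11, h21, ha.const_of_zero] at h1
  rw [h22, ha.const_of_zero, hb.const_of_zero] at h2
  rw [ha.const_of_zero, hb.const_of_zero]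
  have ha0 : a 0 = 0 := by linear_combination h1
  rw [ha0] at h2
  exact ⟨ha0, by linear_combination h2⟩

/-- Restriction to an affine line is polynomial. -/
theorem Hg.poly {k : ℕ} {f : V4 → ℂ} (hf : Hg k f) (p q : V4) :
    ∃ P : Polynomial ℂ, ∀ t, f (p + t • q) = P.eval t := by
  induction k generalizing f with
  | zero => exact ⟨Polynomial.C (f 0), fun t => by rw [hf.const_of_zero]; simp⟩
  | succ k ih =>
    obtain ⟨F, hF, hfF⟩ := hf.decomp
    choose P hP using fun i => ih (hF i)
    refine ⟨∑ i, (Polynomial.C (p i) + Polynomial.X * Polynomial.C (q i)) * P i, fun t => ?_⟩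
    rw [hfF, Polynomial.eval_finsetSum]
    refine Finset.sum_congr rfl fun i _ => ?_
    rw [hP i]
    simp
    left
    ring

/-- A binary form without nontrivial zeros is constant. -/
theorem Hg.no_root {k : ℕ} {f : V4 → ℂ} (hf : Hg k f) (p q : V4)
    (h : ∀ s t : ℂ, (s ≠ 0 ∨ t ≠ 0) → f (s • p + t • q) ≠ 0) : k = 0 := by
  by_contra hk
  obtain ⟨P, hP⟩ := hf.poly p q
  have hdeg : P.degree = 0 := by
    by_contra hd
    obtain ⟨t, ht⟩ := IsAlgClosed.exists_root P hd
    have := h 1 t (by simp)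
    rw [one_smul, hP, ht] at this
    exact this rfl
  rw [Polynomial.eq_C_of_degree_eq_zero hdeg] at hP
  simp only [Polynomial.eval_C] at hP
  have := eq_of_ne_zero (f := fun s : ℂ => f (s • p + q)) (g := fun s : ℂ => s ^ k * P.coeff 0)
    (by have := hf.cont; fun_prop) (by fun_prop) (by
      filter_upwards [self_mem_nhdsWithin] with s hs
      have hs' : s ≠ 0 := hs
      rw [← hP s⁻¹, ← hf.hom, smul_add, smul_smul, mul_inv_cancel₀ hs', one_smul])
  simp [hk] at this
  exact h 0 1 (by simp) (by simpa using this)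


/-- The determinant of four vectors. -/
def d4 (p q r s : V4) : ℂ :=
  (p 0 * q 1 - p 1 * q 0) * (r 2 * s 3 - r 3 * s 2) - (p 0 * q 2 - p 2 * q 0) * (r 1 * s 3 - r 3 * s 1)
  + (p 0 * q 3 - p 3 * q 0) * (r 1 * s 2 - r 2 * s 1) + (p 1 * q 2 - p 2 * q 1) * (r 0 * s 3 - r 3 * s 0)
  - (p 1 * q 3 - p 3 * q 1) * (r 0 * s 2 - r 2 * s 0) + (p 2 * q 3 - p 3 * q 2) * (r 0 * s 1 - r 1 * s 0)

theorem d4_eq_det (M : Matrix (Fin 4) (Fin 4) ℂ) : M.det = d4 (M 0) (M 1) (M 2) (M 3) := by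
  rw [Matrix.det_succ_row_zero]
  simp [Fin.sum_univ_succ, Matrix.det_fin_three, Fin.succAbove, d4]
  ring

/-- Linear substitutions in the determinant. -/
theorem d4_map (A : V4 →ₗ[ℂ] V4) (p q r s : V4) :
    d4 (A p) (A q) (A r) (A s) = LinearMap.det A * d4 p q r s := by
  have h1 := d4_eq_det (Matrix.of ![p, q, r, s])
  have h2 := d4_eq_det (Matrix.of ![A p, A q, A r, A s])
  have h3 : Matrix.of ![A p, A q, A r, A s] = Matrix.of ![p, q, r, s] * (LinearMap.toMatrix' A).transpose := by
    ext i j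
    have hA : ∀ x : V4, A x j = ∑ k, x k * LinearMap.toMatrix' A j k := by
      intro x
      conv_lhs => rw [← Matrix.toLin'_toMatrix' A]
      simp only [Matrix.toLin'_apply, Matrix.mulVec, dotProduct]
      exact Finset.sum_congr rfl fun k _ => mul_comm _ _
    rw [Matrix.mul_apply]
    fin_cases i <;> exact hA _
  rw [h3, Matrix.det_mul, Matrix.det_transpose, LinearMap.det_toMatrix', h1] at h2
  have h4 : d4 p q r s * LinearMap.det A = d4 (A p) (A q) (A r) (A s) := by
    rw [← h3] at h2
    exact h2
  rw [← h4]; ring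

/-- The exterior differential. -/
noncomputable def Gd (o : V4 → V4 →ₗ[ℂ] ℂ) (z a b : V4) : ℂ :=
  fderiv ℂ (fun y => o y b) z a - fderiv ℂ (fun y => o y a) z b


theorem Gd_hg {d : ℕ} {o : V4 → V4 →ₗ[ℂ] ℂ} (ho : ∀ v, Hg (d + 1) (fun z => o z v))
    (a b : V4) : Hg d (fun z => Gd o z a b) :=
  ((ho b).fderiv a).sub ((ho a).fderiv b)

theorem fd_add {d : ℕ} {o : V4 → V4 →ₗ[ℂ] ℂ} (ho : ∀ v, Hg (d + 1) (fun z => o z v))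
    (a b : V4) (z : V4) : fderiv ℂ (fun y => o y (a + b)) z
    = fderiv ℂ (fun y => o y a) z + fderiv ℂ (fun y => o y b) z := by
  simp only [map_add]
  exact fderiv_fun_add ((ho a).diff z) ((ho b).diff z)

theorem fd_smul {d : ℕ} {o : V4 → V4 →ₗ[ℂ] ℂ} (ho : ∀ v, Hg (d + 1) (fun z => o z v))
    (c : ℂ) (b : V4) (z : V4) : fderiv ℂ (fun y => o y (c • b)) z
    = c • fderiv ℂ (fun y => o y b) z := by
  simp only [map_smul]
  exact fderiv_fun_const_smul ((ho b).diff z) c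

theorem Gd_swap {o : V4 → V4 →ₗ[ℂ] ℂ}
    (z a b : V4) : Gd o z a b = - Gd o z b a := by
  simp [Gd]

theorem Gd_self {o : V4 → V4 →ₗ[ℂ] ℂ}
    (z a : V4) : Gd o z a a = 0 := by
  simp [Gd]

theorem Gd_add {d : ℕ} {o : V4 → V4 →ₗ[ℂ] ℂ} (ho : ∀ v, Hg (d + 1) (fun z => o z v))
    (z a a' b : V4) : Gd o z (a + a') b = Gd o z a b + Gd o z a' b := by
  simp only [Gd]
  rw [fd_add ho, map_add, add_apply]
  ring

theorem Gd_smul {d : ℕ} {o : V4 → V4 →ₗ[ℂ] ℂ} (ho : ∀ v, Hg (d + 1) (fun z => o z v))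
    (z a b : V4) (c : ℂ) : Gd o z (c • a) b = c * Gd o z a b := by
  simp only [Gd]
  rw [fd_smul ho, map_smul, smul_apply, smul_eq_mul, smul_eq_mul]
  ring

theorem Gd_add_right {d : ℕ} {o : V4 → V4 →ₗ[ℂ] ℂ} (ho : ∀ v, Hg (d + 1) (fun z => o z v))
    (z a b b' : V4) : Gd o z a (b + b') = Gd o z a b + Gd o z a b' := by
  simp only [Gd]
  rw [fd_add ho, map_add, add_apply]
  ring

theorem Gd_smul_right {d : ℕ} {o : V4 → V4 →ₗ[ℂ] ℂ} (ho : ∀ v, Hg (d + 1) (fun z => o z v))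
    (z a b : V4) (c : ℂ) : Gd o z a (c • b) = c * Gd o z a b := by
  simp only [Gd]
  rw [fd_smul ho, map_smul, smul_apply, smul_eq_mul, smul_eq_mul]
  ring

theorem Gd_left {d : ℕ} {o : V4 → V4 →ₗ[ℂ] ℂ} (ho : ∀ v, Hg (d + 1) (fun z => o z v))
    (z a b : V4) : Gd o z a b = a 0 * Gd o z (ee 0) b + a 1 * Gd o z (ee 1) b
    + a 2 * Gd o z (ee 2) b + a 3 * Gd o z (ee 3) b := by
  have h := sum_ee a
  rw [Fin.sum_univ_four] at h
  conv_lhs => rw [h]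
  simp only [Gd_add ho, Gd_smul ho]

theorem Gd_right {d : ℕ} {o : V4 → V4 →ₗ[ℂ] ℂ} (ho : ∀ v, Hg (d + 1) (fun z => o z v))
    (z a b : V4) : Gd o z a b = b 0 * Gd o z a (ee 0) + b 1 * Gd o z a (ee 1)
    + b 2 * Gd o z a (ee 2) + b 3 * Gd o z a (ee 3) := by
  have h := sum_ee b
  rw [Fin.sum_univ_four] at h
  conv_lhs => rw [h]
  simp only [Gd_add_right ho, Gd_smul_right ho]

/-- Coordinate expression of an alternating form. -/
theorem Gd_coord {d : ℕ} {o : V4 → V4 →ₗ[ℂ] ℂ} (ho : ∀ v, Hg (d + 1) (fun z => o z v))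
    (z a b : V4) : Gd o z a b =
    (a 0 * b 1 - a 1 * b 0) * Gd o z (ee 0) (ee 1) + (a 0 * b 2 - a 2 * b 0) * Gd o z (ee 0) (ee 2)
    + (a 0 * b 3 - a 3 * b 0) * Gd o z (ee 0) (ee 3) + (a 1 * b 2 - a 2 * b 1) * Gd o z (ee 1) (ee 2)
    + (a 1 * b 3 - a 3 * b 1) * Gd o z (ee 1) (ee 3) + (a 2 * b 3 - a 3 * b 2) * Gd o z (ee 2) (ee 3) := by
  rw [Gd_left ho z a b, Gd_right ho z _ b, Gd_right ho z _ b, Gd_right ho z _ b, Gd_right ho z _ b]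
  rw [Gd_swap z (ee 1) (ee 0), Gd_swap z (ee 2) (ee 0), Gd_swap z (ee 3) (ee 0),
    Gd_swap z (ee 2) (ee 1), Gd_swap z (ee 3) (ee 1), Gd_swap z (ee 3) (ee 2)]
  simp only [Gd_self]
  ring

theorem o_coord {o : V4 → V4 →ₗ[ℂ] ℂ}
    (z v : V4) : o z v = v 0 * o z (ee 0) + v 1 * o z (ee 1)
    + v 2 * o z (ee 2) + v 3 * o z (ee 3) := by
  have h := sum_ee v
  rw [Fin.sum_univ_four] at h
  conv_lhs => rw [h]
  simp only [map_add, map_smul, smul_eq_mul]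

/-- Derivative of a tangency relation. -/
theorem tan_fd {d : ℕ} {o : V4 → V4 →ₗ[ℂ] ℂ} (ho : ∀ v, Hg (d + 1) (fun z => o z v))
    (T : V4 →ₗ[ℂ] V4) (h : ∀ y, o y (T y) = 0) (z b : V4) :
    fderiv ℂ (fun y => o y (T z)) z b = - o z (T b) := by
  have hl : ∀ i : Fin 4, HasFDerivAt (fun y => T y i)
      (LinearMap.toContinuousLinearMap ((LinearMap.proj i : V4 →ₗ[ℂ] ℂ) ∘ₗ T)) z := fun i =>
    (LinearMap.toContinuousLinearMap ((LinearMap.proj i : V4 →ₗ[ℂ] ℂ) ∘ₗ T)).hasFDerivAt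
  have hp : ∀ i : Fin 4, HasFDerivAt (fun y => T y i * o y (ee i)) _ z := fun i =>
    (hl i).mul ((ho (ee i)).diff z).hasFDerivAt
  have hs := ((hp 0).add (hp 1)).add (hp 2) |>.add (hp 3)
  have hz : HasFDerivAt (fun y => o y (T y)) (0 : V4 →L[ℂ] ℂ) z := by
    simp only [h]; exact hasFDerivAt_const _ _
  have hs' := hz.congr_of_eventuallyEq (f₁ := (((fun y => T y 0 * o y (ee 0)) + fun y => T y 1 * o y (ee 1)) +
        fun y => T y 2 * o y (ee 2)) + fun y => T y 3 * o y (ee 3))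
    (Eventually.of_forall fun y => by simp only [Pi.add_apply]; exact (o_coord y (T y)).symm)
  have hu := congrArg (fun L : V4 →L[ℂ] ℂ => L b) (hs.unique hs')
  simp at hu
  have hf : ∀ i, DifferentiableAt ℂ (fun y => o y (ee i)) z := fun i => (ho (ee i)).diff z
  have h1 : fderiv ℂ (fun y => o y (T z)) z b = T z 0 * fderiv ℂ (fun y => o y (ee 0)) z b
     + T z 1 * fderiv ℂ (fun y => o y (ee 1)) z b + T z 2 * fderiv ℂ (fun y => o y (ee 2)) z b
     + T z 3 * fderiv ℂ (fun y => o y (ee 3)) z b := by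
    have h := sum_ee (T z)
    rw [Fin.sum_univ_four] at h
    conv_lhs => rw [h]
    simp only [fd_add ho, fd_smul ho]
    simp
  rw [h1, o_coord z (T b)]
  linear_combination hu

theorem Gd_euler {d : ℕ} {o : V4 → V4 →ₗ[ℂ] ℂ} (ho : ∀ v, Hg (d + 1) (fun z => o z v))
    (hr : ∀ z, o z z = 0) (z b : V4) : Gd o z z b = (d + 2) * o z b := by
  have h1 := tan_fd ho LinearMap.id hr z b
  have h2 := (ho b).euler z
  simp only [LinearMap.id_apply] at h1
  simp only [Gd]
  rw [h1, h2]
  push_cast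
  ring


/-- The reduced situation: a homogeneous form annihilating the radial field, invariant under
the linear vector field `T`, with small singular set and locally free tangent sheaf. -/
structure Su (d : ℕ) (o : V4 → V4 →ₗ[ℂ] ℂ) (T : V4 →ₗ[ℂ] V4) : Prop where
  hol : ∀ v, Hg (d + 1) (fun z => o z v)
  rad : ∀ z, o z z = 0
  dim : dimH {z | ∀ v, o z v = 0} < 6
  free : ∀ q : V4, q ≠ 0 → ∃ X Y : V4 → V4, AnalyticAt ℂ X q ∧ AnalyticAt ℂ Y q ∧
    ∀ᶠ z in 𝓝 q, ∀ v, o z v = d4 (X z) (Y z) z v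
  inv : ∀ z b, Gd o z (T z) b = 0

/-- Global splitting. -/
def Spl (o : V4 → V4 →ₗ[ℂ] ℂ) : Prop :=
  ∃ (X1 X2 : V4 → V4) (d1 d2 : ℕ), AnalyticOnNhd ℂ X1 univ ∧ AnalyticOnNhd ℂ X2 univ ∧
    (∀ (t : ℂ) z, X1 (t • z) = t ^ d1 • X1 z) ∧ (∀ (t : ℂ) z, X2 (t • z) = t ^ d2 • X2 z) ∧
    ∀ z v, o z v = d4 (X1 z) (X2 z) z v

theorem two_ne (d : ℕ) : (d : ℂ) + 2 ≠ 0 := by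
  exact_mod_cast Nat.succ_ne_zero (d + 1)

theorem Su.tan {d : ℕ} {o : V4 → V4 →ₗ[ℂ] ℂ} {T : V4 →ₗ[ℂ] V4} (h : Su d o T) (z : V4) :
    o z (T z) = 0 := by
  have h1 := Gd_euler h.hol h.rad z (T z)
  rw [Gd_swap, h.inv z z, neg_zero] at h1
  exact (mul_eq_zero.1 h1.symm).resolve_left (two_ne d)

theorem Su.o_eq {d : ℕ} {o : V4 → V4 →ₗ[ℂ] ℂ} {T : V4 →ₗ[ℂ] V4} (h : Su d o T) (z v : V4) :
    o z v = ((d : ℂ) + 2)⁻¹ * Gd o z z v := by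
  rw [Gd_euler h.hol h.rad z v, inv_mul_cancel_left₀ (two_ne d)]

/-- Pull back by a linear isomorphism. -/
noncomputable def pull (A : V4 ≃ₗ[ℂ] V4) (o : V4 → V4 →ₗ[ℂ] ℂ) : V4 → V4 →ₗ[ℂ] ℂ :=
  fun z => (o (A z)) ∘ₗ (A : V4 →ₗ[ℂ] V4)

theorem Gd_pull {d : ℕ} {o : V4 → V4 →ₗ[ℂ] ℂ} (ho : ∀ v, Hg (d + 1) (fun z => o z v))
    (A : V4 ≃ₗ[ℂ] V4) (z a b : V4) : Gd (pull A o) z a b = Gd o (A z) (A a) (A b) := by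
  have key : ∀ a b : V4, fderiv ℂ (fun y => pull A o y b) z a = fderiv ℂ (fun y => o y (A b)) (A z) (A a) := by
    intro a b
    have h1 : HasFDerivAt (fun y => pull A o y b) _ z :=
      HasFDerivAt.comp (g := fun y => o y (A b)) (f := fun y => A y) z
        ((ho (A b)).diff (A z)).hasFDerivAt
        (LinearMap.toContinuousLinearMap (A : V4 →ₗ[ℂ] V4)).hasFDerivAt
    rw [h1.fderiv]
    rfl
  simp only [Gd, key]

theorem smul_d4 (c : ℂ) (p q r s : V4) : d4 (c • p) q r s = c * d4 p q r s := by
  simp only [d4, Pi.smul_apply, smul_eq_mul]; ring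

theorem det_ne (A : V4 ≃ₗ[ℂ] V4) : LinearMap.det (A : V4 →ₗ[ℂ] V4) ≠ 0 :=
  (LinearEquiv.isUnit_det' A).ne_zero

theorem Su.pull {d : ℕ} {o : V4 → V4 →ₗ[ℂ] ℂ} {T : V4 →ₗ[ℂ] V4} (h : Su d o T)
    (A : V4 ≃ₗ[ℂ] V4) :
    Su d (pull A o) ((A.symm : V4 →ₗ[ℂ] V4) ∘ₗ T ∘ₗ (A : V4 →ₗ[ℂ] V4)) := by
  have hAc : Continuous A := (A : V4 →ₗ[ℂ] V4).continuous_of_finiteDimensional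
  refine ⟨fun v => (h.hol (A v)).comp (A : V4 →ₗ[ℂ] V4), fun z => h.rad (A z), ?_, ?_, ?_⟩
  · have h1 : {z | ∀ v, _root_.pull A o z v = 0} = A.symm.toContinuousLinearEquiv '' {z | ∀ v, o z v = 0} := by
      ext z
      simp only [mem_ofPred_eq, mem_image, _root_.pull]
      constructor
      · intro hz
        refine ⟨A z, fun v => ?_, by simp⟩
        simpa using hz (A.symm v)
      · rintro ⟨w, hw, rfl⟩ v
        simpa using hw (A v)
    rw [h1, ContinuousLinearEquiv.dimH_image]
    exact h.dim
  · intro q hq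
    obtain ⟨X, Y, hX, hY, hXY⟩ := h.free (A q) (by simpa using hq)
    refine ⟨fun z => (LinearMap.det (A : V4 →ₗ[ℂ] V4)) • A.symm (X (A z)), fun z => A.symm (Y (A z)), ?_, ?_, ?_⟩
    · have h1 : AnalyticAt ℂ (fun z => X (A z)) q :=
        hX.comp_of_eq (lin_an (A : V4 →ₗ[ℂ] V4) q (mem_univ _)) rfl
      have h2 : AnalyticAt ℂ (fun z => A.symm (X (A z))) q :=
        (lin_an (A.symm : V4 →ₗ[ℂ] V4) _ (mem_univ _)).comp_of_eq h1 rfl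
      exact h2.const_smul (c := LinearMap.det (A : V4 →ₗ[ℂ] V4))
    · have h1 : AnalyticAt ℂ (fun z => Y (A z)) q :=
        hY.comp_of_eq (lin_an (A : V4 →ₗ[ℂ] V4) q (mem_univ _)) rfl
      exact (lin_an (A.symm : V4 →ₗ[ℂ] V4) _ (mem_univ _)).comp_of_eq h1 rfl
    · filter_upwards [hAc.continuousAt.eventually hXY] with z hz v
      have h1 := d4_map (A : V4 →ₗ[ℂ] V4) (A.symm (X (A z))) (A.symm (Y (A z))) z v
      rw [smul_d4, ← h1]
      simpa [_root_.pull] using hz (A v)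
  · intro z b
    rw [Gd_pull h.hol]
    simpa using h.inv (A z) (A b)

theorem Spl.of_pull {o : V4 → V4 →ₗ[ℂ] ℂ} (A : V4 ≃ₗ[ℂ] V4) (h : Spl (pull A o)) : Spl o := by
  obtain ⟨X1, X2, d1, d2, h1, h2, h3, h4, h5⟩ := h
  have han : ∀ X : V4 → V4, AnalyticOnNhd ℂ X univ → AnalyticOnNhd ℂ (fun z => A (X (A.symm z))) univ := by
    intro X hX z _
    have h1 : AnalyticAt ℂ (fun z => X (A.symm z)) z :=
        (hX _ (mem_univ _)).comp_of_eq (lin_an (A.symm : V4 →ₗ[ℂ] V4) z (mem_univ _)) rfl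
    exact (lin_an (A : V4 →ₗ[ℂ] V4) _ (mem_univ _)).comp_of_eq h1 rfl
  refine ⟨fun z => (LinearMap.det (A : V4 →ₗ[ℂ] V4))⁻¹ • A (X1 (A.symm z)), fun z => A (X2 (A.symm z)), d1, d2,
    analyticOnNhd_const.smul (han X1 h1), han X2 h2, ?_, ?_, ?_⟩
  · intro t z
    simp only [map_smul, h3]
    rw [smul_comm]
  · intro t z
    simp only [map_smul, h4]
  · intro z v
    have h6 := h5 (A.symm z) (A.symm v)
    have h7 := d4_map (A : V4 →ₗ[ℂ] V4) (X1 (A.symm z)) (X2 (A.symm z)) (A.symm z) (A.symm v)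
    simp only [LinearEquiv.coe_coe, LinearEquiv.apply_symm_apply] at h7
    rw [smul_d4, h7, inv_mul_cancel_left₀ (det_ne A), ← h6]
    simp [pull]

/-- Vector fields with homogeneous components. -/
theorem hgv_an {k : ℕ} {Y : Fin 4 → V4 → ℂ} (hY : ∀ i, Hg k (Y i)) (c : ℂ) :
    AnalyticOnNhd ℂ (fun z => c • (fun i => Y i z : V4)) univ := by
  apply analyticOnNhd_const.smul
  intro z hz
  exact AnalyticAt.pi fun i => (hY i).an z hz

theorem hgv_hom {k : ℕ} {Y : Fin 4 → V4 → ℂ} (hY : ∀ i, Hg k (Y i)) (c t : ℂ) (z : V4) :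
    c • (fun i => Y i (t • z) : V4) = t ^ k • c • (fun i => Y i z : V4) := by
  ext i
  simp only [Pi.smul_apply, smul_eq_mul, (hY i).hom]
  ring

/-- A factorization of the differential yields a splitting. -/
theorem Su.spl_of {d k l : ℕ} {o : V4 → V4 →ₗ[ℂ] ℂ} {T : V4 →ₗ[ℂ] V4} (h : Su d o T)
    (X Y : Fin 4 → V4 → ℂ) (hX : ∀ i, Hg k (X i)) (hY : ∀ i, Hg l (Y i))
    (h01 : ∀ z, Gd o z (ee 0) (ee 1) = X 2 z * Y 3 z - X 3 z * Y 2 z)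
    (h02 : ∀ z, Gd o z (ee 0) (ee 2) = -(X 1 z * Y 3 z - X 3 z * Y 1 z))
    (h03 : ∀ z, Gd o z (ee 0) (ee 3) = X 1 z * Y 2 z - X 2 z * Y 1 z)
    (h12 : ∀ z, Gd o z (ee 1) (ee 2) = X 0 z * Y 3 z - X 3 z * Y 0 z)
    (h13 : ∀ z, Gd o z (ee 1) (ee 3) = -(X 0 z * Y 2 z - X 2 z * Y 0 z))
    (h23 : ∀ z, Gd o z (ee 2) (ee 3) = X 0 z * Y 1 z - X 1 z * Y 0 z) : Spl o := by
  refine ⟨fun z => ((d : ℂ) + 2)⁻¹ • (fun i => X i z : V4), fun z => (1:ℂ) • (fun i => Y i z : V4), k, l,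
    hgv_an hX _, hgv_an hY _, hgv_hom hX _, hgv_hom hY _, ?_⟩
  intro z v
  rw [h.o_eq, Gd_coord h.hol, h01, h02, h03, h12, h13, h23, smul_d4]
  simp only [d4, one_smul]
  ring

/-- The rank one case. -/
theorem Su.rank_one {d : ℕ} {o : V4 → V4 →ₗ[ℂ] ℂ} {T : V4 →ₗ[ℂ] V4} (h : Su d o T)
    (l : V4 →ₗ[ℂ] ℂ) (u : V4) (hu : l u ≠ 0) (hT : ∀ z, T z = l z • ee 0) : Spl o := by
  have h0 : ∀ b z, Gd o z (ee 0) b = 0 := by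
    intro b
    refine cancel_lin (f := fun z => Gd o z (ee 0) b) (g := fun _ => 0) (Gd_hg h.hol _ _).cont
      continuous_const l u hu ?_
    intro z
    have := h.inv z b
    rw [hT, Gd_smul h.hol] at this
    simpa using this
  have hY : ∀ i, Hg d ((![fun _ => 0, fun z => Gd o z (ee 2) (ee 3), fun z => - Gd o z (ee 1) (ee 3),
        fun z => Gd o z (ee 1) (ee 2)] : Fin 4 → V4 → ℂ) i) := by
    intro i
    fin_cases i
    · exact Hg.zero d
    · exact Gd_hg h.hol _ _
    · exact (Gd_hg h.hol _ _).neg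
    · exact Gd_hg h.hol _ _
  have hX : ∀ i, Hg 0 ((![fun _ => 1, fun _ => 0, fun _ => 0, fun _ => 0] : Fin 4 → V4 → ℂ) i) := by
    intro i
    fin_cases i <;> exact Hg.const _
  apply h.spl_of _ _ hX hY <;> intro z <;> simp [h0]

/-- Degree zero. -/
theorem Su.deg_zero {o : V4 → V4 →ₗ[ℂ] ℂ} {T : V4 →ₗ[ℂ] V4} (h : Su 0 o T)
    (u1 u2 : V4) (h1 : T u1 = ee 0) (h2 : T u2 = ee 1) : Spl o := by
  have hc : ∀ a b z w, Gd o z a b = Gd o w a b := fun a b z w => by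
    rw [(Gd_hg h.hol a b).const_of_zero z, (Gd_hg h.hol a b).const_of_zero w]
  have h0 : ∀ b z, Gd o z (ee 0) b = 0 := fun b z => by
    rw [hc _ _ z u1, ← h1, h.inv]
  have h0' : ∀ b z, Gd o z (ee 1) b = 0 := fun b z => by
    rw [hc _ _ z u2, ← h2, h.inv]
  have hY : ∀ i, Hg 0 ((![fun _ => 0, fun z => Gd o z (ee 2) (ee 3), fun _ => 0,
        fun _ => 0] : Fin 4 → V4 → ℂ) i) := by
    intro i
    fin_cases i
    · exact Hg.zero 0
    · exact Gd_hg h.hol _ _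
    · exact Hg.zero 0
    · exact Hg.zero 0
  have hX : ∀ i, Hg 0 ((![fun _ => 1, fun _ => 0, fun _ => 0, fun _ => 0] : Fin 4 → V4 → ℂ) i) := by
    intro i
    fin_cases i <;> exact Hg.const _
  apply h.spl_of _ _ hX hY <;> intro z <;> simp [h0, h0']

theorem Hg.lin (l : V4 →ₗ[ℂ] ℂ) : Hg 1 (fun z => l z) := by
  simpa using (Hg.const 1).lmul l

/-- The division lemma. -/
theorem Su.div {d : ℕ} {o : V4 → V4 →ₗ[ℂ] ℂ} {T : V4 →ₗ[ℂ] V4} (h : Su d o T)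
    (u1 u2 : V4) (h1 : T u1 = ee 0) (h2 : T u2 = ee 1)
    (hg : ∀ z, T z 0 = 0 → T z 1 = 0 → Gd o z (ee 2) (ee 3) = 0) : Spl o := by
  obtain _ | d := d
  · exact h.deg_zero u1 u2 h1 h2
  let l : Fin 4 → V4 →ₗ[ℂ] ℂ := fun i => (LinearMap.proj i : V4 →ₗ[ℂ] ℂ) ∘ₗ T
  have hl : ∀ i z, l i z = T z i := fun i z => rfl
  have l01 : l 0 u1 = 1 := by simp [hl, h1]
  have l02 : l 0 u2 = 0 := by simp [hl, h2]
  have l11 : l 1 u1 = 0 := by simp [hl, h1]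
  have l12 : l 1 u2 = 1 := by simp [hl, h2]
  have hinv : ∀ b z, l 0 z * Gd o z (ee 0) b + l 1 z * Gd o z (ee 1) b + l 2 z * Gd o z (ee 2) b
      + l 3 z * Gd o z (ee 3) b = 0 := by
    intro b z
    rw [← h.inv z b, Gd_left h.hol z (T z) b]
    simp only [hl]
  have hG := fun a b => Gd_hg h.hol a b
  obtain ⟨Y1, Y0, hY1, hY0, e23⟩ := (hG (ee 2) (ee 3)).div2 (l 0) (l 1) u1 u2 l01 l02 l11 l12 hg
  -- second column
  obtain ⟨Y2, hY2, e03, e13⟩ := ((hG (ee 0) (ee 3)).add (hY1.lmul (l 2))).syz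
    ((hG (ee 1) (ee 3)).add (hY0.lmul (l 2))) (l 0) (l 1) u1 u2 l01 l11 l12 (by
      intro z
      have := hinv (ee 3) z
      rw [e23, Gd_self] at this
      linear_combination this)
  obtain ⟨Y3, hY3, e02, e12⟩ := ((hG (ee 0) (ee 2)).sub (hY1.lmul (l 3))).syz
    ((hG (ee 1) (ee 2)).sub (hY0.lmul (l 3))) (l 0) (l 1) u1 u2 l01 l11 l12 (by
      intro z
      have := hinv (ee 2) z
      rw [Gd_swap z (ee 3), e23, Gd_self] at this
      linear_combination this)
  have e01 : ∀ z, Gd o z (ee 0) (ee 1) = - (l 2 z * Y3 z + l 3 z * Y2 z) := by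
    refine cancel_lin (f := fun z => Gd o z (ee 0) (ee 1)) (hG _ _).cont
      ((hY3.lmul (l 2)).add (hY2.lmul (l 3))).neg.cont (l 0) u1 (by simp [l01]) ?_
    intro z
    have := hinv (ee 1) z
    rw [Gd_swap z (ee 2), Gd_swap z (ee 3), Gd_self] at this
    linear_combination this + l 2 z * e12 z + l 3 z * e13 z
  have hX : ∀ i, Hg 1 ((fun i z => l i z : Fin 4 → V4 → ℂ) i) := fun i => Hg.lin _
  have hY : ∀ i, Hg d ((![fun z => - Y0 z, Y1, Y2, fun z => - Y3 z] : Fin 4 → V4 → ℂ) i) := by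
    intro i
    fin_cases i
    · exact hY0.neg
    · exact hY1
    · exact hY2
    · exact hY3.neg
  apply h.spl_of _ _ hX hY <;> intro z <;> simp
  · linear_combination e01 z
  · linear_combination e02 z
  · linear_combination e03 z
  · linear_combination e12 z
  · linear_combination e13 z
  · linear_combination e23 z


theorem d4_plucker (Z X Q R v w : V4) :
    d4 Z Q R v * d4 X Q R w - d4 Z Q R w * d4 X Q R v = - (d4 X Q R Z * d4 v Q R w) := by
  simp only [d4]; ring

theorem d4_cramer (X Y R v Z : V4) :
    d4 X Y R v • Z = d4 Z Y R v • X + d4 X Z R v • Y + d4 X Y Z v • R + d4 X Y R Z • v := by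
  ext i
  simp only [d4, Pi.smul_apply, Pi.add_apply, smul_eq_mul]
  fin_cases i <;> simp <;> ring

theorem d4_an {P Q R : V4 → V4} {q : V4} (v : V4) (hP : AnalyticAt ℂ P q) (hQ : AnalyticAt ℂ Q q)
    (hR : AnalyticAt ℂ R q) : AnalyticAt ℂ (fun z => d4 (P z) (Q z) (R z) v) q := by
  have h1 := fun i => analyticAt_pi_iff.1 hP i
  have h2 := fun i => analyticAt_pi_iff.1 hQ i
  have h3 := fun i => analyticAt_pi_iff.1 hR i
  simp only [d4]
  fun_prop

/-- One coefficient of a tangent field in a local frame. -/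
theorem Su.coef {d : ℕ} {o : V4 → V4 →ₗ[ℂ] ℂ} {T : V4 →ₗ[ℂ] V4} (h : Su d o T) (q : V4)
    (P Q R Z : V4 → V4) (hP : AnalyticAt ℂ P q) (hQ : AnalyticAt ℂ Q q) (hR : AnalyticAt ℂ R q)
    (hZ : AnalyticAt ℂ Z q) (hZt : ∀ z, o z (Z z) = 0)
    (he : ∀ᶠ z in 𝓝 q, ∀ v, o z v = d4 (P z) (Q z) (R z) v) :
    ∃ f : V4 → ℂ, ContDiffAt ℂ 1 f q ∧ ∀ᶠ z in 𝓝 q, ∀ v, d4 (Z z) (Q z) (R z) v = f z * o z v := by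
  have hall := (((hP.eventually_analyticAt.and hQ.eventually_analyticAt).and
    hR.eventually_analyticAt).and hZ.eventually_analyticAt).and he
  refine hartogs_div (fun v z => o z v) (fun v z => d4 (Z z) (Q z) (R z) v) q _ hall
    (fun v => (h.hol v).an) h.dim (fun v z hz => d4_an v hz.1.2 hz.1.1.1.2 hz.1.1.2) ?_
  intro z hz v w
  have h1 := d4_plucker (Z z) (P z) (Q z) (R z) v w
  rw [← hz.2, ← hz.2, ← hz.2, hZt] at h1
  linear_combination h1

/-- Coefficients of a tangent field in a local frame. -/
theorem Su.coefs {d : ℕ} {o : V4 → V4 →ₗ[ℂ] ℂ} {T : V4 →ₗ[ℂ] V4} (h : Su d o T) (q : V4)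
    (X Y Z : V4 → V4) (hX : AnalyticAt ℂ X q) (hY : AnalyticAt ℂ Y q)
    (hZ : AnalyticAt ℂ Z q) (hZt : ∀ z, o z (Z z) = 0)
    (he : ∀ᶠ z in 𝓝 q, ∀ v, o z v = d4 (X z) (Y z) z v) :
    ∃ f g k : V4 → ℂ, ContDiffAt ℂ 1 f q ∧ ContDiffAt ℂ 1 g q ∧ ContDiffAt ℂ 1 k q ∧
      ∀ᶠ z in 𝓝 q, (∃ v, o z v ≠ 0) → Z z = f z • X z + g z • Y z + k z • z := by
  obtain ⟨f, hf, hfe⟩ := h.coef q X Y (fun z => z) Z hX hY analyticAt_id hZ hZt he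
  obtain ⟨g, hg, hge⟩ := h.coef q Y (fun z => z) X Z hY analyticAt_id hX hZ hZt (by
    filter_upwards [he] with z hz v
    rw [hz]; simp only [d4]; ring)
  obtain ⟨k, hk, hke⟩ := h.coef q (fun z => z) X Y Z analyticAt_id hX hY hZ hZt (by
    filter_upwards [he] with z hz v
    rw [hz]; simp only [d4]; ring)
  refine ⟨f, g, k, hf, hg, hk, ?_⟩
  filter_upwards [hfe, hge, hke, he] with z h1 h2 h3 h4
  rintro ⟨v, hv⟩
  have hc := d4_cramer (X z) (Y z) z v (Z z)
  rw [← h4 (Z z), hZt, zero_smul, add_zero, ← h4 v, h1 v] at hc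
  have e2 : d4 (X z) (Z z) z v = g z * o z v := by
    rw [← h2 v]; simp only [d4]; ring
  have e3 : d4 (X z) (Y z) (Z z) v = k z * o z v := by
    rw [← h3 v]; simp only [d4]; ring
  rw [e2, e3] at hc
  apply smul_right_injective V4 hv
  simp only [smul_add, smul_smul]
  rw [hc]
  congr 1
  · congr 1
    · rw [mul_comm]
    · rw [mul_comm]
  · rw [mul_comm]

/-- The regular points are dense. -/
theorem Su.dense {d : ℕ} {o : V4 → V4 →ₗ[ℂ] ℂ} {T : V4 →ₗ[ℂ] V4} (h : Su d o T) :
    Dense {z | ∃ v, o z v ≠ 0} := by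
  have h1 : {z | ∃ v, o z v ≠ 0} = {z | ∀ v, o z v = 0}ᶜ := by
    ext z; simp
  rw [h1]
  apply dense_compl_of_dimH_lt_finrank
  refine h.dim.trans ?_
  have : Module.finrank ℝ V4 = 8 := by
    rw [← Module.finrank_mul_finrank ℝ ℂ V4]
    simp
  rw [this]
  norm_num



theorem line_cont {F : Type*} [TopologicalSpace F] {f : V4 → F} (hf : Continuous f) (z u : V4) :
    ContinuousAt (fun t : ℂ => f (z + t • u)) 0 := by
  have : Continuous (fun t : ℂ => f (z + t • u)) := by fun_prop
  exact this.continuousAt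

/-- On the kernel, the derivative of the form is killed by the image of `T`. -/
theorem Su.kill {d : ℕ} {o : V4 → V4 →ₗ[ℂ] ℂ} {T : V4 →ₗ[ℂ] V4} (h : Su d o T)
    (z u b : V4) (hz : T z = 0) : Gd o z (T u) b = 0 := by
  have := eq_of_ne_zero (f := fun t : ℂ => Gd o (z + t • u) (T u) b) (g := fun _ => 0)
    (line_cont (Gd_hg h.hol (T u) b).cont z u) continuousAt_const (by
      filter_upwards [self_mem_nhdsWithin] with t ht
      have h1 := h.inv (z + t • u) b
      rw [map_add, map_smul, hz, zero_add, Gd_smul h.hol] at h1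
      exact (mul_eq_zero.1 h1).resolve_left ht)
  simpa using this

theorem Su.on_ker {d : ℕ} {o : V4 → V4 →ₗ[ℂ] ℂ} {T : V4 →ₗ[ℂ] V4} (h : Su d o T)
    (u1 u2 : V4) (h1 : T u1 = ee 0) (h2 : T u2 = ee 1) (z v : V4) (hz : T z = 0) :
    ((d : ℂ) + 2) * o z v = Gd o z (ee 2) (ee 3) * d4 (ee 0) (ee 1) z v := by
  have k0 : ∀ b, Gd o z (ee 0) b = 0 := fun b => by rw [← h1]; exact h.kill z u1 b hz
  have k1 : ∀ b, Gd o z (ee 1) b = 0 := fun b => by rw [← h2]; exact h.kill z u2 b hz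
  have k0' : ∀ b, Gd o z b (ee 0) = 0 := fun b => by rw [Gd_swap, k0, neg_zero]
  have k1' : ∀ b, Gd o z b (ee 1) = 0 := fun b => by rw [Gd_swap, k1, neg_zero]
  rw [← Gd_euler h.hol h.rad z v]
  have hs : Gd o z z v = Gd o z (∑ i, z i • ee i) (∑ i, v i • ee i) := by
    rw [← sum_ee z, ← sum_ee v]
  rw [hs]
  simp only [Fin.sum_univ_four, Gd_add h.hol, Gd_smul h.hol, Gd_add_right h.hol,
    Gd_smul_right h.hol]
  rw [Gd_swap (o := o) z (ee 3) (ee 2)]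
  simp only [k0, k1, k0', k1', Gd_self]
  simp [d4]
  ring

/-- The local computation at a regular point of the kernel. -/
theorem Su.local_ker {d : ℕ} {o : V4 → V4 →ₗ[ℂ] ℂ} {T : V4 →ₗ[ℂ] V4} (h : Su d o T)
    (u1 u2 : V4) (h1 : T u1 = ee 0) (h2 : T u2 = ee 1) (q : V4) (hq : T q = 0)
    (v : V4) (hv : o q v ≠ 0) (X Y : V4 → V4) (hX : DifferentiableAt ℂ X q)
    (hY : DifferentiableAt ℂ Y q) (he : ∀ v, o q v = d4 (X q) (Y q) q v)
    (f g k : V4 → ℂ) (hf : DifferentiableAt ℂ f q) (hg : DifferentiableAt ℂ g q)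
    (hk : DifferentiableAt ℂ k q) (hT : ∀ᶠ z in 𝓝 q, T z = f z • X z + g z • Y z + k z • z) :
    (fderiv ℂ f q u1 * fderiv ℂ g q u2 - fderiv ℂ f q u2 * fderiv ℂ g q u1) *
      Gd o q (ee 2) (ee 3) = (d : ℂ) + 2 := by
  have h0 := hT.self_of_nhds
  rw [hq] at h0
  have e0 : ∀ i, f q * X q i + g q * Y q i + k q * q i = 0 := fun i => by
    have := congrFun h0 i
    simpa using this.symm
  have hv' := hv
  rw [he] at hv'
  have f0 : f q = 0 := by
    have : f q * d4 (X q) (Y q) q v = d4 (fun i => f q * X q i + g q * Y q i + k q * q i) (Y q) q v := by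
      simp only [d4]; ring
    simp only [e0] at this
    have h3 : d4 (fun i => 0) (Y q) q v = 0 := by simp [d4]
    rw [h3] at this
    exact (mul_eq_zero.1 this).resolve_right hv'
  have g0 : g q = 0 := by
    have : g q * d4 (X q) (Y q) q v = d4 (X q) (fun i => f q * X q i + g q * Y q i + k q * q i) q v := by
      simp only [d4]; ring
    simp only [e0] at this
    have h3 : d4 (X q) (fun i => 0) q v = 0 := by simp [d4]
    rw [h3] at this
    exact (mul_eq_zero.1 this).resolve_right hv'
  have k0 : k q = 0 := by
    have : k q * d4 (X q) (Y q) q v = d4 (X q) (Y q) (fun i => f q * X q i + g q * Y q i + k q * q i) v := by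
      simp only [d4]; ring
    simp only [e0] at this
    have h3 : d4 (X q) (Y q) (fun i => 0) v = 0 := by simp [d4]
    rw [h3] at this
    exact (mul_eq_zero.1 this).resolve_right hv'
  have hd : ∀ a, T a = fderiv ℂ f q a • X q + fderiv ℂ g q a • Y q + fderiv ℂ k q a • q := by
    intro a
    have d1 : HasFDerivAt (fun z => T z) (LinearMap.toContinuousLinearMap T) q :=
      (LinearMap.toContinuousLinearMap T).hasFDerivAt
    have d2 := ((hf.hasFDerivAt.smul hX.hasFDerivAt).add (hg.hasFDerivAt.smul hY.hasFDerivAt)).add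
      (hk.hasFDerivAt.smul (hasFDerivAt_id (𝕜 := ℂ) q))
    have d3 := d1.unique (d2.congr_of_eventuallyEq hT)
    have d4 := congrArg (fun L => L a) d3
    simpa [f0, g0, k0] using d4
  have hdd : ∀ w, d4 (ee 0) (ee 1) q w =
      (fderiv ℂ f q u1 * fderiv ℂ g q u2 - fderiv ℂ f q u2 * fderiv ℂ g q u1) * o q w := by
    intro w
    rw [← h1, ← h2, hd u1, hd u2, he]
    simp only [d4, Pi.add_apply, Pi.smul_apply, smul_eq_mul]
    ring
  have h5 := h.on_ker u1 u2 h1 h2 q v hq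
  rw [hdd v] at h5
  apply mul_right_cancel₀ hv
  linear_combination -h5

theorem eventually_line_ne {k : ℕ} {f : V4 → ℂ} (hf : Hg k f) (q p : V4) (hp : f (q + p) ≠ 0) :
    ∀ᶠ t : ℂ in 𝓝[≠] 0, f (q + t • p) ≠ 0 := by
  have ha : AnalyticOnNhd ℂ (fun t : ℂ => f (q + t • p)) univ := by
    intro t _
    have h1 : AnalyticAt ℂ (fun t : ℂ => q + t • p) t := by fun_prop
    exact (hf.an _ (mem_univ _)).comp_of_eq h1 rfl
  rcases (ha 0 (mem_univ _)).eventually_eq_zero_or_eventually_ne_zero with h0 | h0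
  · exfalso
    have := ha.eqOn_zero_of_preconnected_of_eventuallyEq_zero isPreconnected_univ (mem_univ 0) h0
      (mem_univ 1)
    simp at this
    exact hp this
  · exact h0

theorem Su.ker_ne {d : ℕ} {o : V4 → V4 →ₗ[ℂ] ℂ} {T : V4 →ₗ[ℂ] V4} (h : Su d o T)
    (u1 u2 : V4) (h1 : T u1 = ee 0) (h2 : T u2 = ee 1) (p v0 : V4) (hp : T p = 0)
    (hpv : o p v0 ≠ 0) (q : V4) (hq : T q = 0) (hq0 : q ≠ 0) : Gd o q (ee 2) (ee 3) ≠ 0 := by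
  obtain ⟨X, Y, hX, hY, he⟩ := h.free q hq0
  obtain ⟨f, g, k, hf, hg, hk, hT⟩ := h.coefs q X Y (fun z => T z) hX hY
    (lin_an T q (mem_univ _)) h.tan he
  have key : ∀ᶠ z in 𝓝 q, T z = 0 → o z v0 ≠ 0 →
    (fderiv ℂ f z u1 * fderiv ℂ g z u2 - fderiv ℂ f z u2 * fderiv ℂ g z u1) *
      Gd o z (ee 2) (ee 3) = (d : ℂ) + 2 := by
    filter_upwards [hX.eventually_analyticAt, hY.eventually_analyticAt, he,
      hf.eventually (by simp), hg.eventually (by simp), hk.eventually (by simp), hT.eventually_nhds]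
      with z a1 a2 a3 a4 a5 a6 a7 hz hzv
    refine h.local_ker u1 u2 h1 h2 z hz v0 hzv X Y a1.differentiableAt a2.differentiableAt a3 f g k
      (a4.differentiableAt (by simp)) (a5.differentiableAt (by simp)) (a6.differentiableAt (by simp)) ?_
    have hc : ∀ᶠ w in 𝓝 z, o w v0 ≠ 0 := (h.hol v0).cont.continuousAt.eventually_ne hzv
    filter_upwards [a7, hc] with w b1 b2
    exact b1 ⟨v0, b2⟩
  have hl : Tendsto (fun t : ℂ => q + t • (p - q)) (𝓝 0) (𝓝 q) := by
    have : Continuous (fun t : ℂ => q + t • (p - q)) := by fun_prop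
    simpa using this.tendsto 0
  have cf : ContinuousAt (fderiv ℂ f) q := (hf.fderiv_right (m := 0) (by simp)).continuousAt
  have cg : ContinuousAt (fderiv ℂ g) q := (hg.fderiv_right (m := 0) (by simp)).continuousAt
  have ca : ContinuousAt (fun z => (fderiv ℂ f z u1 * fderiv ℂ g z u2 - fderiv ℂ f z u2 * fderiv ℂ g z u1) *
      Gd o z (ee 2) (ee 3)) q := by
    have := (Gd_hg h.hol (ee 2) (ee 3)).cont.continuousAt (x := q)
    fun_prop
  have hfin := eq_of_ne_zero (f := fun t : ℂ => (fun z => (fderiv ℂ f z u1 * fderiv ℂ g z u2 - fderiv ℂ f z u2 * fderiv ℂ g z u1) *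
      Gd o z (ee 2) (ee 3)) (q + t • (p - q))) (g := fun _ => (d : ℂ) + 2)
      (ContinuousAt.comp_of_eq ca (by fun_prop) (by simp)) continuousAt_const (by
        filter_upwards [(hl.eventually key).filter_mono nhdsWithin_le_nhds,
          eventually_line_ne (h.hol v0) q (p - q) (by simpa using hpv)] with t b1 b2
        exact b1 (by simp [hp, hq]) b2)
  intro h0
  simp only [zero_smul, add_zero, h0, mul_zero] at hfin
  exact two_ne d hfin.symm

/-- The case where `T` has rank at least two and nonzero square. -/
theorem Su.sq_ne {d : ℕ} {o : V4 → V4 →ₗ[ℂ] ℂ} {T : V4 →ₗ[ℂ] V4} (h : Su d o T)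
    (u1 u2 : V4) (h1 : T u1 = ee 0) (h2 : T u2 = ee 1) (w : V4) (hw : T (T w) ≠ 0) : Spl o := by
  by_cases hL : ∃ k, T k 0 = 0 ∧ T k 1 = 0 ∧ T k ≠ 0
  · obtain ⟨k, hk0, hk1, hk⟩ := hL
    have key : ∀ z, T z 0 = 0 → T z 1 = 0 → T z ≠ 0 → Gd o z (ee 2) (ee 3) = 0 := by
      intro z z0 z1 hz
      have ht : T z = T z 2 • ee 2 + T z 3 • ee 3 := by
        conv_lhs => rw [sum_ee (T z)]
        simp [Fin.sum_univ_four, z0, z1]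
      have i2 := h.inv z (ee 2)
      have i3 := h.inv z (ee 3)
      rw [ht, Gd_add h.hol, Gd_smul h.hol, Gd_smul h.hol, Gd_self] at i2 i3
      rw [Gd_swap] at i2
      by_contra hc
      have e3 : T z 3 = 0 := by
        by_contra h3
        exact mul_ne_zero h3 hc (by linear_combination -i2)
      have e2 : T z 2 = 0 := by
        by_contra h3
        exact mul_ne_zero h3 hc (by linear_combination i3)
      rw [e2, e3] at ht
      simp at ht
      exact hz ht
    refine h.div u1 u2 h1 h2 fun z z0 z1 => ?_
    by_cases hz : T z = 0
    · have := eq_of_ne_zero (f := fun t : ℂ => Gd o (z + t • k) (ee 2) (ee 3)) (g := fun _ => 0)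
        (line_cont (Gd_hg h.hol (ee 2) (ee 3)).cont z k) continuousAt_const (by
          filter_upwards [self_mem_nhdsWithin] with t ht
          exact key _ (by simp [hz, hk0]) (by simp [hz, hk1])
            (by rw [map_add, map_smul, hz, zero_add]; exact smul_ne_zero ht hk))
      simpa using this
    · exact key z z0 z1 hz
  · push Not at hL
    by_cases hg : ∀ z, T z 0 = 0 → T z 1 = 0 → Gd o z (ee 2) (ee 3) = 0
    · exact h.div u1 u2 h1 h2 hg
    push Not at hg
    obtain ⟨r, r0, r1, hr⟩ := hg
    have hTr : T r = 0 := hL r r0 r1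
    have hT : ∀ z, T z = T z 0 • ee 0 + T z 1 • ee 1 := by
      intro z
      have := hL (z - T z 0 • u1 - T z 1 • u2) (by simp [h1, h2]) (by simp [h1, h2])
      simp only [map_sub, map_smul, h1, h2] at this
      linear_combination (exp := 1) this
    -- the kernel has dimension two
    let R := LinearMap.range T
    let K := LinearMap.ker T
    have hR : R ≤ Submodule.span ℂ {ee 0, ee 1} := by
      rintro _ ⟨z, rfl⟩
      rw [hT z, Submodule.mem_span_pair]
      exact ⟨_, _, rfl⟩
    have hRd : Module.finrank ℂ R ≤ 2 := by
      refine (Submodule.finrank_mono hR).trans ?_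
      have := finrank_span_le_card (R := ℂ) ({ee 0, ee 1} : Set V4)
      refine this.trans ?_
      simpa using Finset.card_le_two
    have hrn := LinearMap.finrank_range_add_finrank_ker T
    have h4 : Module.finrank ℂ V4 = 4 := by simp
    have hKd : 2 ≤ Module.finrank ℂ K := by
      change Module.finrank ℂ R + Module.finrank ℂ K = _ at hrn
      omega
    have hp' : ∃ p, T p = 0 ∧ (p 2 ≠ 0 ∨ p 3 ≠ 0) := by
      by_contra hc
      push Not at hc
      have hKR : K ≤ Submodule.span ℂ {ee 0, ee 1} := by
        intro z hz
        obtain ⟨a, b⟩ := hc z hz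
        rw [Submodule.mem_span_pair]
        refine ⟨z 0, z 1, ?_⟩
        conv_rhs => rw [sum_ee z]
        simp [Fin.sum_univ_four, a, b]
      have hs : Module.finrank ℂ (Submodule.span ℂ ({ee 0, ee 1} : Set V4)) ≤ 2 := by
        have := finrank_span_le_card (R := ℂ) ({ee 0, ee 1} : Set V4)
        refine this.trans ?_
        simpa using Finset.card_le_two
      have heq := Submodule.eq_of_le_of_finrank_le hKR (hs.trans hKd)
      have : T w ∈ K := by
        rw [heq]; exact hR ⟨w, rfl⟩
      exact hw this
    obtain ⟨p, hp, hp23⟩ := hp'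
    obtain ⟨v, hv⟩ : ∃ v, d4 (ee 0) (ee 1) p v ≠ 0 := by
      rcases hp23 with h3 | h3
      · exact ⟨ee 3, by simpa [d4] using h3⟩
      · exact ⟨ee 2, by simpa [d4] using h3⟩
    have hreg : ∃ p1, T p1 = 0 ∧ o p1 v ≠ 0 := by
      by_contra hc
      push Not at hc
      have hz : ∀ z, T z = 0 → Gd o z (ee 2) (ee 3) * d4 (ee 0) (ee 1) z v = 0 := fun z hz => by
        rw [← h.on_ker u1 u2 h1 h2 z v hz, hc z hz, mul_zero]
      have hd : Continuous (fun z => d4 (ee 0) (ee 1) z v) := by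
        simp only [d4]; fun_prop
      have h5 := eventually_line_ne (Gd_hg h.hol (ee 2) (ee 3)) p (r - p) (by simpa using hr)
      have := eq_of_ne_zero (f := fun t : ℂ => d4 (ee 0) (ee 1) (p + t • (r - p)) v)
        (g := fun _ => 0) (line_cont hd p (r - p)) continuousAt_const (by
          filter_upwards [h5] with t ht
          exact (mul_eq_zero.1 (hz _ (by simp [hp, hTr]))).resolve_left ht)
      simp only [zero_smul, add_zero] at this
      exact hv this
    obtain ⟨p1, hp1, hp1v⟩ := hreg
    have hne := h.ker_ne u1 u2 h1 h2 p1 v hp1 hp1v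
    obtain ⟨b0, hb0⟩ : ∃ b : K, b ≠ 0 :=
      Module.finrank_pos_iff_exists_ne_zero.1 (by change 0 < Module.finrank ℂ K; omega)
    obtain ⟨b1, hb⟩ := exists_linearIndependent_pair_of_one_lt_finrank (R := ℂ) (M := K) hKd hb0
    have hd : d = 0 := by
      refine (Gd_hg h.hol (ee 2) (ee 3)).no_root (b0 : V4) (b1 : V4) fun s t hst => ?_
      refine hne _ ?_ ?_
      · have e0 : T b0 = 0 := b0.2
        have e1 : T b1 = 0 := b1.2
        rw [map_add, map_smul, map_smul, e0, e1, smul_zero, smul_zero, add_zero]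
      · intro h0
        have h6 : s • b0 + t • b1 = 0 := by
          apply Subtype.ext; simpa using h0
        have := LinearIndependent.pair_iff.1 hb s t h6
        rcases hst with h | h
        · exact h this.1
        · exact h this.2
    subst hd
    exact h.deg_zero u1 u2 h1 h2


theorem ee_val (i j : Fin 4) : ee i j = if j = i then 1 else 0 := by
  simp [ee, Pi.single_apply]

theorem Su.lie {d : ℕ} {o : V4 → V4 →ₗ[ℂ] ℂ} {T : V4 →ₗ[ℂ] V4} (h : Su d o T) (z b : V4) :
    fderiv ℂ (fun y => o y b) z (T z) + o z (T b) = 0 := by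
  have h1 := h.inv z b
  rw [Gd, tan_fd h.hol T h.tan z b] at h1
  linear_combination h1

theorem fd_xmul {f : V4 → ℂ} {z : V4} (hf : DifferentiableAt ℂ f z) (i : Fin 4) (a : V4) :
    fderiv ℂ (fun y => y i * f y) z a = a i * f z + z i * fderiv ℂ f z a := by
  have h1 : HasFDerivAt (fun y : V4 => y i) (ContinuousLinearMap.proj (R := ℂ) (φ := fun _ => ℂ) i) z :=
    (ContinuousLinearMap.proj (R := ℂ) (φ := fun _ : Fin 4 => ℂ) i).hasFDerivAt
  rw [(h1.fun_mul hf.hasFDerivAt).fderiv]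
  simp
  ring

theorem fd_coord (f : V4 → ℂ) (z a : V4) : fderiv ℂ f z a = a 0 * fderiv ℂ f z (ee 0)
    + a 1 * fderiv ℂ f z (ee 1) + a 2 * fderiv ℂ f z (ee 2) + a 3 * fderiv ℂ f z (ee 3) := by
  have h := sum_ee a
  rw [Fin.sum_univ_four] at h
  conv_lhs => rw [h]
  simp only [map_add, map_smul, smul_eq_mul]

noncomputable abbrev pr (i : Fin 4) : V4 →ₗ[ℂ] ℂ := LinearMap.proj i

theorem Su.nil_form {e : ℕ} {o : V4 → V4 →ₗ[ℂ] ℂ} {T : V4 →ₗ[ℂ] V4} (h : Su (e + 1) o T)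
    (hT : ∀ z, T z = z 2 • ee 0 + z 3 • ee 1) : ∃ k m : V4 → ℂ, Hg (e + 1) k ∧ Hg (e + 1) m ∧
    (∀ z, o z (ee 0) = z 3 * k z) ∧ (∀ z, o z (ee 1) = - (z 2 * k z)) ∧
    (∀ z, o z (ee 2) = z 1 * k z + z 3 * m z) ∧ (∀ z, o z (ee 3) = - (z 0 * k z) - z 2 * m z) ∧
    (∀ z, z 2 * fderiv ℂ k z (ee 0) + z 3 * fderiv ℂ k z (ee 1) = 0) ∧
    (∀ z, z 2 * fderiv ℂ m z (ee 0) + z 3 * fderiv ℂ m z (ee 1) = - 2 * k z) := by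
  obtain ⟨k, hk, k0, k1⟩ := (h.hol (ee 0)).syz (h.hol (ee 1)) (pr 2) (pr 3) (ee 2) (ee 3)
    (by simp) (by simp) (by simp) (fun z => by
      have := h.tan z
      rw [hT, map_add, map_smul, map_smul] at this
      simpa using this)
  simp only [LinearMap.coe_proj, Function.eval] at k0 k1
  obtain ⟨m, hm, m0, m1⟩ := ((h.hol (ee 2)).sub (hk.xmul 1)).syz ((h.hol (ee 3)).add (hk.xmul 0))
    (pr 2) (pr 3) (ee 2) (ee 3) (by simp) (by simp) (by simp) (fun z => by
      have := h.rad z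
      rw [o_coord] at this
      rw [k0, k1] at this
      simp only [LinearMap.coe_proj, Function.eval]
      linear_combination this)
  simp only [LinearMap.coe_proj, Function.eval] at m0 m1
  have o2 : ∀ z, o z (ee 2) = z 1 * k z + z 3 * m z := fun z => by linear_combination m0 z
  have o3 : ∀ z, o z (ee 3) = - (z 0 * k z) - z 2 * m z := fun z => by linear_combination m1 z
  have T0 : T (ee 0) = 0 := by rw [hT]; simp
  have T2 : T (ee 2) = ee 0 := by rw [hT]; simp
  have D : ∀ (f : V4 → ℂ) z, fderiv ℂ f z (T z) = z 2 * fderiv ℂ f z (ee 0) + z 3 * fderiv ℂ f z (ee 1) := by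
    intro f z
    rw [hT, map_add, map_smul, map_smul, smul_eq_mul, smul_eq_mul]
  have c0 : Continuous (fun z => z 2 * fderiv ℂ k z (ee 0) + z 3 * fderiv ℂ k z (ee 1)) := by
    have := (hk.fderiv (ee 0)).cont
    have := (hk.fderiv (ee 1)).cont
    fun_prop
  have c1 : Continuous (fun z => z 2 * fderiv ℂ m z (ee 0) + z 3 * fderiv ℂ m z (ee 1)) := by
    have := (hm.fderiv (ee 0)).cont
    have := (hm.fderiv (ee 1)).cont
    fun_prop
  have hDk := cancel_lin c0 (continuous_const (y := 0)) (pr 3) (ee 3) (by simp) (fun z => by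
      have := h.lie z (ee 0)
      simp only [T0, map_zero, k0] at this
      rw [fd_xmul (hk.diff z), hT] at this
      rw [← D]
      simp at this
      simp [hT]
      exact this)
  have hDm := cancel_lin c1 (hk.cmul (-2)).cont (pr 3) (ee 3) (by simp) (fun z => by
      have := h.lie z (ee 2)
      simp only [T2, k0, o2] at this
      rw [fderiv_fun_add ((hk.xmul 1).diff z) ((hm.xmul 3).diff z), add_apply,
        fd_xmul (hk.diff z), fd_xmul (hm.diff z), D, D, hDk] at this
      simp [hT] at this
      simp
      linear_combination this)
  exact ⟨k, m, hk, hm, k0, k1, o2, o3, hDk, hDm⟩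


theorem Su.nil_div {e : ℕ} {o : V4 → V4 →ₗ[ℂ] ℂ} {T : V4 →ₗ[ℂ] V4} (h : Su (e + 1) o T)
    (hT : ∀ z, T z = z 2 • ee 0 + z 3 • ee 1) (k m : V4 → ℂ) (hk : Hg (e + 1) k)
    (hm : Hg (e + 1) m)
    (o2 : ∀ z, o z (ee 2) = z 1 * k z + z 3 * m z)
    (o3 : ∀ z, o z (ee 3) = - (z 0 * k z) - z 2 * m z)
    (hDm : ∀ z, z 2 * fderiv ℂ m z (ee 0) + z 3 * fderiv ℂ m z (ee 1) = - 2 * k z)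
    (hL : ∀ z : V4, z 2 = 0 → z 3 = 0 → m z = 0) : Spl o := by
  refine h.div (ee 2) (ee 3) (by rw [hT]; simp) (by rw [hT]; simp) fun z z2 z3 => ?_
  rw [hT] at z2 z3
  simp at z2 z3
  have hkk : ∀ a, - 2 * fderiv ℂ k z a = a 2 * fderiv ℂ m z (ee 0) + a 3 * fderiv ℂ m z (ee 1) := by
    intro a
    have e1 : fderiv ℂ (fun y => - 2 * k y) z a = - 2 * fderiv ℂ k z a := by
      rw [fderiv_const_mul (hk.diff z)]; rfl
    rw [← e1]
    simp only [← hDm]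
    rw [fderiv_fun_add (((hm.fderiv (ee 0)).xmul 2).diff z) (((hm.fderiv (ee 1)).xmul 3).diff z),
      add_apply, fd_xmul ((hm.fderiv (ee 0)).diff z), fd_xmul ((hm.fderiv (ee 1)).diff z), z2, z3]
    ring
  have g : Gd o z (ee 2) (ee 3) = (- (z 0 * fderiv ℂ k z (ee 2)) - m z) - (z 1 * fderiv ℂ k z (ee 3) + m z) := by
    rw [Gd]
    simp only [o2, o3]
    rw [fderiv_fun_sub ((hk.xmul 0).neg.diff z) ((hm.xmul 2).diff z), sub_apply, fderiv_fun_neg, neg_apply,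
      fderiv_fun_add ((hk.xmul 1).diff z) ((hm.xmul 3).diff z), add_apply,
      fd_xmul (hk.diff z), fd_xmul (hk.diff z), fd_xmul (hm.diff z), fd_xmul (hm.diff z), z2, z3]
    simp
  have a2 := hkk (ee 2)
  have a3 := hkk (ee 3)
  simp at a2 a3
  have he := hm.euler z
  rw [fd_coord, z2, z3, hL z z2 z3] at he
  rw [g, hL z z2 z3]
  linear_combination (1/2) * he + (1/2) * z 0 * a2 + (1/2) * z 1 * a3

theorem Su.nil_high {e : ℕ} {o : V4 → V4 →ₗ[ℂ] ℂ} {T : V4 →ₗ[ℂ] V4} (h : Su (e + 1 + 1) o T)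
    (hT : ∀ z, T z = z 2 • ee 0 + z 3 • ee 1) : Spl o := by
  obtain ⟨k, m, hk, hm, o0, o1, o2, o3, hDk, hDm⟩ := h.nil_form hT
  refine h.nil_div hT k m hk hm o2 o3 hDm fun z z2 z3 => ?_
  have hx := hm.fderiv (ee 0)
  have hy := hm.fderiv (ee 1)
  have hkk : ∀ z, ∀ a : V4, a 2 = 0 → a 3 = 0 → - 2 * fderiv ℂ k z a =
      z 2 * fderiv ℂ (fun y => fderiv ℂ m y (ee 0)) z a + z 3 * fderiv ℂ (fun y => fderiv ℂ m y (ee 1)) z a := by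
    intro z a ha2 ha3
    have e1 : fderiv ℂ (fun y => - 2 * k y) z a = - 2 * fderiv ℂ k z a := by
      rw [fderiv_const_mul (hk.diff z)]; rfl
    rw [← e1]
    simp only [← hDm]
    rw [fderiv_fun_add ((hx.xmul 2).diff z) ((hy.xmul 3).diff z),
      add_apply, fd_xmul (hx.diff z), fd_xmul (hy.diff z), ha2, ha3]
    ring
  have hxx := hx.fderiv (ee 0)
  have hxy := hx.fderiv (ee 1)
  have hyx := hy.fderiv (ee 0)
  have hyy := hy.fderiv (ee 1)
  set mx := fun y => fderiv ℂ m y (ee 0) with hmx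
  set my := fun y => fderiv ℂ m y (ee 1) with hmy
  set mxx := fun y => fderiv ℂ mx y (ee 0) with hmxx
  set mxy := fun y => fderiv ℂ mx y (ee 1) with hmxy
  set myx := fun y => fderiv ℂ my y (ee 0) with hmyx
  set myy := fun y => fderiv ℂ my y (ee 1) with hmyy
  have key : ∀ z : V4, z 2 ^ 2 * mxx z + z 2 * z 3 * (myx z + mxy z) + z 3 ^ 2 * myy z = 0 := by
    intro z
    have e0 := hkk z (ee 0) (by simp) (by simp)
    have e1 := hkk z (ee 1) (by simp) (by simp)
    have e2 := hDk z
    simp only [hmxx, hmxy, hmyx, hmyy]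
    linear_combination -2 * e2 - z 2 * e0 - z 3 * e1
  have zxx : mxx z = 0 := by
    have := eq_of_ne_zero (f := fun t : ℂ => mxx (z + t • ee 2)) (g := fun _ => 0)
      (line_cont hxx.cont z (ee 2)) continuousAt_const (by
        filter_upwards [self_mem_nhdsWithin] with t ht
        have := key (z + t • ee 2)
        simp [z2, z3] at this
        exact this.resolve_left ht)
    simpa using this
  have zyy : myy z = 0 := by
    have := eq_of_ne_zero (f := fun t : ℂ => myy (z + t • ee 3)) (g := fun _ => 0)
      (line_cont hyy.cont z (ee 3)) continuousAt_const (by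
        filter_upwards [self_mem_nhdsWithin] with t ht
        have := key (z + t • ee 3)
        simp [z2, z3] at this
        exact this.resolve_left ht)
    simpa using this
  have zxy : mxx z + (myx z + mxy z) + myy z = 0 := by
    have hc : Continuous (fun z => mxx z + (myx z + mxy z) + myy z) :=
      (hxx.cont.add (hyx.cont.add hxy.cont)).add hyy.cont
    have := eq_of_ne_zero (f := fun t : ℂ => (fun z => mxx z + (myx z + mxy z) + myy z) (z + t • (ee 2 + ee 3)))
      (g := fun _ => 0)
      (line_cont hc z (ee 2 + ee 3)) continuousAt_const (by
        filter_upwards [self_mem_nhdsWithin] with t ht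
        have := key (z + t • (ee 2 + ee 3))
        have e2 : (z + t • (ee 2 + ee 3)) 2 = t := by simp [z2]
        have e3 : (z + t • (ee 2 + ee 3)) 3 = t := by simp [z3]
        rw [e2, e3] at this
        apply mul_left_cancel₀ (pow_ne_zero 2 ht)
        linear_combination this)
    simpa using this
  have E0 := hm.euler z
  have E1 := hx.euler z
  have E2 := hy.euler z
  rw [fd_coord, z2, z3] at E0 E1 E2
  simp only [hmxx, hmxy, hmyx, hmyy, hmx, hmy] at E1 E2 zxx zyy zxy
  have n1 : ((e : ℂ) + 1) ≠ 0 := by exact_mod_cast Nat.succ_ne_zero e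
  apply mul_left_cancel₀ (mul_ne_zero n1 (two_ne e))
  push_cast at E0 E1 E2
  rw [zxx, zyy] at zxy
  rw [zxx] at E1
  rw [zyy] at E2
  linear_combination -(((e : ℂ) + 1)) * E0 - z 0 * E1 - z 1 * E2 + z 0 * z 1 * zxy


theorem lin_rel (q : V4) (l1 l2 l3 : V4 →ₗ[ℂ] ℂ) (h1 : l1 q = 0) (h2 : l2 q = 0) (h3 : l3 q = 0)
    (f1 f2 f3 : V4 → ℂ) (c1 : ContinuousAt f1 q) (c2 : ContinuousAt f2 q) (c3 : ContinuousAt f3 q)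
    (h : ∀ᶠ z in 𝓝 q, f1 z * l1 z + f2 z * l2 z + f3 z * l3 z = 0) (a : V4) :
    f1 q * l1 a + f2 q * l2 a + f3 q * l3 a = 0 := by
  have hl : Tendsto (fun t : ℂ => q + t • a) (𝓝 0) (𝓝 q) := by
    have : Continuous (fun t : ℂ => q + t • a) := by fun_prop
    simpa using this.tendsto 0
  have cc : ContinuousAt (fun z => f1 z * l1 a + f2 z * l2 a + f3 z * l3 a) q := by fun_prop
  have := eq_of_ne_zero (f := fun t : ℂ => (fun z => f1 z * l1 a + f2 z * l2 a + f3 z * l3 a) (q + t • a))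
    (g := fun _ => 0) (ContinuousAt.comp_of_eq cc (by fun_prop) (by simp)) continuousAt_const (by
      filter_upwards [self_mem_nhdsWithin, (hl.eventually h).filter_mono nhdsWithin_le_nhds] with t ht h4
      simp only [map_add, map_smul, h1, h2, h3, zero_add, smul_eq_mul] at h4
      apply mul_left_cancel₀ ht
      linear_combination h4)
  simpa using this

theorem d4_minor (X Y q v : V4) (f1 g1 k1 f2 g2 k2 : ℂ) :
    d4 (f1 • X + g1 • Y + k1 • q) (f2 • X + g2 • Y + k2 • q) q v = (f1 * g2 - f2 * g1) * d4 X Y q v := by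
  simp only [d4, Pi.add_apply, Pi.smul_apply, smul_eq_mul]
  ring

theorem minor_eq {U : Set V4} (hU : Dense U) {q : V4} {f g : V4 → ℂ}
    (hf : ∀ᶠ z in 𝓝 q, ContinuousAt f z) (hg : ∀ᶠ z in 𝓝 q, ContinuousAt g z)
    (h : ∀ᶠ z in 𝓝 q, z ∈ U → f z = g z) : ∀ᶠ z in 𝓝 q, f z = g z := by
  filter_upwards [hf, hg, h.eventually_nhds] with z a b c
  have hne : (𝓝[U] z).NeBot := mem_closure_iff_nhdsWithin_neBot.1 (hU z)
  have e1 : Tendsto f (𝓝[U] z) (𝓝 (f z)) := a.tendsto.mono_left nhdsWithin_le_nhds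
  have e2 : Tendsto g (𝓝[U] z) (𝓝 (g z)) := b.tendsto.mono_left nhdsWithin_le_nhds
  refine tendsto_nhds_unique_of_eventuallyEq e1 e2 ?_
  filter_upwards [self_mem_nhdsWithin, c.filter_mono nhdsWithin_le_nhds] with w hw h2
  exact h2 hw

theorem Su.minor {d : ℕ} {o : V4 → V4 →ₗ[ℂ] ℂ} {T : V4 →ₗ[ℂ] V4} (h : Su d o T) {q : V4}
    {X Y : V4 → V4} (he : ∀ᶠ z in 𝓝 q, ∀ v, o z v = d4 (X z) (Y z) z v) (A B : V4 → V4)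
    (l : V4 →ₗ[ℂ] ℂ)
    (hl : ∀ z v, d4 (A z) (B z) z v = l z * o z v) (f1 g1 k1 f2 g2 k2 : V4 → ℂ)
    (cf1 : ContDiffAt ℂ 1 f1 q) (cf2 : ContDiffAt ℂ 1 f2 q)
    (cg1 : ContDiffAt ℂ 1 g1 q) (cg2 : ContDiffAt ℂ 1 g2 q)
    (h1 : ∀ᶠ z in 𝓝 q, (∃ v, o z v ≠ 0) → A z = f1 z • X z + g1 z • Y z + k1 z • z)
    (h2 : ∀ᶠ z in 𝓝 q, (∃ v, o z v ≠ 0) → B z = f2 z • X z + g2 z • Y z + k2 z • z) :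
    ∀ᶠ z in 𝓝 q, f1 z * g2 z - f2 z * g1 z = l z := by
  refine minor_eq h.dense ?_ ?_ ?_
  · have := (cf1.mul cg2).sub (cf2.mul cg1)
    filter_upwards [this.eventually (by simp)] with z hz
    exact hz.continuousAt
  · exact Eventually.of_forall fun z => (lin_an l z (mem_univ _)).continuousAt
  · filter_upwards [he, h1, h2] with z a b c
    rintro ⟨v, hv⟩
    have := hl z v
    rw [b ⟨v, hv⟩, c ⟨v, hv⟩, d4_minor, ← a] at this
    exact mul_right_cancel₀ hv this

theorem Su.nil_one_contra {o : V4 → V4 →ₗ[ℂ] ℂ} {T : V4 →ₗ[ℂ] V4} (h : Su 1 o T)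
    (hT : ∀ z, T z = z 2 • ee 0 + z 3 • ee 1) (a b c2 c3 : ℂ) (hab : a ≠ 0 ∨ b ≠ 0)
    (o0 : ∀ z, o z (ee 0) = z 3 * (a * z 2 + b * z 3))
    (o1 : ∀ z, o z (ee 1) = - (z 2 * (a * z 2 + b * z 3)))
    (o2 : ∀ z, o z (ee 2) = z 1 * (a * z 2 + b * z 3) + z 3 * (-2 * (a * z 0 + b * z 1) + c2 * z 2 + c3 * z 3))
    (o3 : ∀ z, o z (ee 3) = - (z 0 * (a * z 2 + b * z 3)) - z 2 * (-2 * (a * z 0 + b * z 1) + c2 * z 2 + c3 * z 3)) :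
    False := by
  let P : V4 →ₗ[ℂ] ℂ := a • pr 0 + b • pr 1 - c2 • pr 2 - c3 • pr 3
  let u : V4 := b • ee 2 - a • ee 3
  let C : V4 →ₗ[ℂ] V4 := P.smulRight (ee 1) - (pr 2).smulRight u
  let C' : V4 →ₗ[ℂ] V4 := P.smulRight (ee 0) + (pr 3).smulRight u
  have hP : ∀ z, P z = a * z 0 + b * z 1 - c2 * z 2 - c3 * z 3 := fun z => by simp [P]
  have hC : ∀ z, C z = P z • ee 1 - z 2 • u := fun z => by simp [C]
  have hC' : ∀ z, C' z = P z • ee 0 + z 3 • u := fun z => by simp [C']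
  have oC : ∀ z, o z (C z) = 0 := fun z => by
    simp only [hC, u, hP, map_sub, map_smul, smul_eq_mul, o1, o2, o3]; ring
  have oC' : ∀ z, o z (C' z) = 0 := fun z => by
    simp only [hC', u, hP, map_add, map_sub, map_smul, smul_eq_mul, o0, o2, o3]; ring
  have m12 : ∀ z v, d4 (T z) (C z) z v = (pr 2) z * o z v := fun z v => by
    rw [o_coord z v, o0, o1, o2, o3, hC, hT, hP]
    simp [d4, u]; ring
  have m13 : ∀ z v, d4 (T z) (C' z) z v = (-(pr 3)) z * o z v := fun z v => by
    rw [o_coord z v, o0, o1, o2, o3, hC', hT, hP]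
    simp [d4, u]; ring
  have m23 : ∀ z v, d4 (C z) (C' z) z v = (-P) z * o z v := fun z v => by
    rw [o_coord z v, o0, o1, o2, o3, hC', hC, LinearMap.neg_apply, hP]
    simp [d4, u]; ring
  let q : V4 := b • ee 0 - a • ee 1
  have q0 : q 0 = b := by simp [q]
  have q1 : q 1 = -a := by simp [q]
  have q2 : q 2 = 0 := by simp [q]
  have q3 : q 3 = 0 := by simp [q]
  have Pq : P q = 0 := by rw [hP, q0, q1, q2, q3]; ring
  have hq : q ≠ 0 := by
    intro h0
    rw [h0] at q0 q1
    simp at q0 q1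
    rcases hab with h | h
    · exact h q1
    · exact h q0.symm
  obtain ⟨X, Y, hX, hY, he⟩ := h.free q hq
  obtain ⟨f1, g1, k1, hf1, hg1, -, e1⟩ := h.coefs q X Y (fun z => T z) hX hY (lin_an T q (mem_univ _)) h.tan he
  obtain ⟨f2, g2, k2, hf2, hg2, -, e2⟩ := h.coefs q X Y (fun z => C z) hX hY (lin_an C q (mem_univ _)) oC he
  obtain ⟨f3, g3, k3, hf3, hg3, -, e3⟩ := h.coefs q X Y (fun z => C' z) hX hY (lin_an C' q (mem_univ _)) oC' he
  have p12 := h.minor he T C (pr 2) m12 f1 g1 k1 f2 g2 k2 hf1 hf2 hg1 hg2 e1 e2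
  have p13 := h.minor he T C' (-(pr 3)) m13 f1 g1 k1 f3 g3 k3 hf1 hf3 hg1 hg3 e1 e3
  have p23 := h.minor he C C' (-P) m23 f2 g2 k2 f3 g3 k3 hf2 hf3 hg2 hg3 e2 e3
  have van : ∀ f1 f2 f3 : V4 → ℂ, ContinuousAt f1 q → ContinuousAt f2 q → ContinuousAt f3 q →
      (∀ᶠ z in 𝓝 q, f1 z * (-P) z + f2 z * (pr 3) z + f3 z * (pr 2) z = 0) → f1 q = 0 ∧ f2 q = 0 := by
    intro f1 f2 f3 c1 c2' c3' hh
    have L := lin_rel q (-P) (pr 3) (pr 2) (by simp [Pq]) (by simp [q3]) (by simp [q2]) f1 f2 f3 c1 c2' c3' hh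
    have L0 := L (ee 0)
    have L1 := L (ee 1)
    have L3 := L (ee 3)
    rw [LinearMap.neg_apply, hP] at L0 L1 L3
    simp at L0 L1 L3
    have f10 : f1 q = 0 := by
      rcases hab with h | h
      · exact L0.resolve_right h
      · exact L1.resolve_right h
    rw [f10] at L3
    simp at L3
    exact ⟨f10, L3⟩
  obtain ⟨F1, F2⟩ := van f1 f2 f3 hf1.continuousAt hf2.continuousAt hf3.continuousAt (by
    filter_upwards [p12, p13, p23] with z r1 r2 r3
    have : (pr 3) z = -((-(pr 3)) z) := by simp
    rw [this, ← r1, ← r2, ← r3]; ring)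
  obtain ⟨G1, G2⟩ := van g1 g2 g3 hg1.continuousAt hg2.continuousAt hg3.continuousAt (by
    filter_upwards [p12, p13, p23] with z r1 r2 r3
    have : (pr 3) z = -((-(pr 3)) z) := by simp
    rw [this, ← r1, ← r2, ← r3]; ring)
  have df1 := (hf1.differentiableAt (by simp)).hasFDerivAt
  have df2 := (hf2.differentiableAt (by simp)).hasFDerivAt
  have dg1 := (hg1.differentiableAt (by simp)).hasFDerivAt
  have dg2 := (hg2.differentiableAt (by simp)).hasFDerivAt
  have D1 := (df1.fun_mul dg2).fun_sub (df2.fun_mul dg1)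
  have D2 : HasFDerivAt (fun z => (pr 2) z) (LinearMap.toContinuousLinearMap (pr 2)) q :=
    (LinearMap.toContinuousLinearMap (pr 2)).hasFDerivAt
  have D3 := D1.unique (D2.congr_of_eventuallyEq p12)
  have D4 := congrArg (fun L => L (ee 2)) D3
  simp [F1, F2, G1, G2] at D4

theorem Su.nil {d : ℕ} {o : V4 → V4 →ₗ[ℂ] ℂ} {T : V4 →ₗ[ℂ] V4} (h : Su d o T)
    (hT : ∀ z, T z = z 2 • ee 0 + z 3 • ee 1) : Spl o := by
  match d, h with
  | 0, h => exact h.deg_zero (ee 2) (ee 3) (by rw [hT]; simp) (by rw [hT]; simp)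
  | e + 1 + 1, h => exact h.nil_high hT
  | 1, h =>
    obtain ⟨k, m, hk, hm, o0, o1, o2, o3, hDk, hDm⟩ := Su.nil_form (e := 0) h hT
    have hme : ∀ z, m z = z 0 * fderiv ℂ m 0 (ee 0) + z 1 * fderiv ℂ m 0 (ee 1)
        + z 2 * fderiv ℂ m 0 (ee 2) + z 3 * fderiv ℂ m 0 (ee 3) := by
      intro z
      have := hm.euler z
      rw [fd_coord, (hm.fderiv (ee 0)).const_of_zero, (hm.fderiv (ee 1)).const_of_zero,
        (hm.fderiv (ee 2)).const_of_zero, (hm.fderiv (ee 3)).const_of_zero] at this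
      rw [this]; simp
    have hke : ∀ z, k z = (-1/2) * (z 2 * fderiv ℂ m 0 (ee 0) + z 3 * fderiv ℂ m 0 (ee 1)) := by
      intro z
      have := hDm z
      rw [(hm.fderiv (ee 0)).const_of_zero, (hm.fderiv (ee 1)).const_of_zero] at this
      rw [this]; ring
    by_cases hab : fderiv ℂ m 0 (ee 0) = 0 ∧ fderiv ℂ m 0 (ee 1) = 0
    · refine Su.nil_div (e := 0) h hT k m hk hm o2 o3 hDm fun z z2 z3 => ?_
      rw [hme, hab.1, hab.2, z2, z3]; simp
    · exfalso
      refine h.nil_one_contra hT (-1/2 * fderiv ℂ m 0 (ee 0)) (-1/2 * fderiv ℂ m 0 (ee 1))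
        (fderiv ℂ m 0 (ee 2)) (fderiv ℂ m 0 (ee 3)) ?_ ?_ ?_ ?_ ?_
      · by_contra hc
        push Not at hc
        simp at hc
        exact hab hc
      · intro z; rw [o0, hke]; ring
      · intro z; rw [o1, hke]; ring
      · intro z; rw [o2, hke, hme]; ring
      · intro z; rw [o3, hke, hme]; ring


theorem frame_equiv (w : Fin 4 → V4) (hw : LinearIndependent ℂ w) :
    ∃ A : V4 ≃ₗ[ℂ] V4, ∀ i, A (ee i) = w i := by
  let b := basisOfLinearIndependentOfCardEqFinrank hw (by simp)
  refine ⟨(Pi.basisFun ℂ (Fin 4)).equiv b (Equiv.refl _), fun i => ?_⟩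
  have := (Pi.basisFun ℂ (Fin 4)).equiv_apply i b (Equiv.refl _)
  simpa [b] using this

theorem frame_two (x y : V4) (h : LinearIndependent ℂ ![x, y]) :
    ∃ A : V4 ≃ₗ[ℂ] V4, A (ee 0) = x ∧ A (ee 1) = y := by
  obtain ⟨p, hp⟩ := exists_linearIndependent_snoc_of_lt_finrank h (by simp)
  obtain ⟨r, hr⟩ := exists_linearIndependent_snoc_of_lt_finrank hp (by simp)
  obtain ⟨A, hA⟩ := frame_equiv _ hr
  exact ⟨A, hA 0, hA 1⟩

theorem Su.split {d : ℕ} {o : V4 → V4 →ₗ[ℂ] ℂ} {T : V4 →ₗ[ℂ] V4} (h : Su d o T) (hT : T ≠ 0) :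
    Spl o := by
  obtain ⟨u1, hu1⟩ : ∃ u, T u ≠ 0 := by
    by_contra hc
    push Not at hc
    exact hT (LinearMap.ext hc)
  by_cases hr : ∃ u2, LinearIndependent ℂ ![T u1, T u2]
  · obtain ⟨u2, hu2⟩ := hr
    by_cases hsq : ∀ z, T (T z) = 0
    · have hli : LinearIndependent ℂ ![T u1, T u2, u1, u2] := by
        rw [Fintype.linearIndependent_iff]
        intro g hg
        simp [Fin.sum_univ_four] at hg
        have h1 := congrArg T hg
        simp only [map_add, map_smul, hsq, smul_zero, zero_add, map_zero] at h1
        obtain ⟨g2, g3⟩ := LinearIndependent.pair_iff.1 hu2 _ _ h1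
        rw [g2, g3, zero_smul, zero_smul, add_zero, add_zero] at hg
        obtain ⟨g0, g1⟩ := LinearIndependent.pair_iff.1 hu2 _ _ hg
        intro i
        fin_cases i <;> assumption
      obtain ⟨A, hA⟩ := frame_equiv _ hli
      have a0 : A (ee 0) = T u1 := hA 0
      have a1 : A (ee 1) = T u2 := hA 1
      have a2 : A (ee 2) = u1 := hA 2
      have a3 : A (ee 3) = u2 := hA 3
      refine Spl.of_pull A ((h.pull A).nil fun z => ?_)
      have hz : A z = z 0 • T u1 + z 1 • T u2 + z 2 • u1 + z 3 • u2 := by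
        conv_lhs => rw [sum_ee z]
        simp only [Fin.sum_univ_four, map_add, map_smul, a0, a1, a2, a3]
      change A.symm (T (A z)) = _
      rw [LinearEquiv.symm_apply_eq, hz]
      simp only [map_add, map_smul, hsq, smul_zero, zero_add, a0, a1]
    · push Not at hsq
      obtain ⟨w, hw⟩ := hsq
      obtain ⟨A, a0, a1⟩ := frame_two _ _ hu2
      refine Spl.of_pull A ((h.pull A).sq_ne (A.symm u1) (A.symm u2) ?_ ?_ (A.symm w) ?_)
      · change A.symm (T (A (A.symm u1))) = _
        rw [LinearEquiv.symm_apply_eq, a0, LinearEquiv.apply_symm_apply]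
      · change A.symm (T (A (A.symm u2))) = _
        rw [LinearEquiv.symm_apply_eq, a1, LinearEquiv.apply_symm_apply]
      · change A.symm (T (A (A.symm (T (A (A.symm w)))))) ≠ 0
        simpa using hw
  · push Not at hr
    have hc : ∀ z, ∃ a : ℂ, a • T u1 = T z := by
      intro z
      have := hr z
      rw [LinearIndependent.pair_iff' hu1] at this
      push Not at this
      exact this
    obtain ⟨y, hy⟩ := exists_linearIndependent_pair_of_one_lt_finrank (R := ℂ) (M := V4) (by simp) hu1
    obtain ⟨A, a0, -⟩ := frame_two _ _ hy
    have hs : A.symm (T u1) = ee 0 := by rw [LinearEquiv.symm_apply_eq, a0]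
    refine Spl.of_pull A ((h.pull A).rank_one
      ((pr 0) ∘ₗ (A.symm : V4 →ₗ[ℂ] V4) ∘ₗ T ∘ₗ (A : V4 →ₗ[ℂ] V4)) (A.symm u1) ?_ ?_)
    · change A.symm (T (A (A.symm u1))) 0 ≠ 0
      rw [LinearEquiv.apply_symm_apply, hs]; simp
    · intro z
      obtain ⟨a, ha⟩ := hc (A z)
      change A.symm (T (A z)) = (A.symm (T (A z)) 0) • ee 0
      rw [← ha, map_smul, hs]
      simp

theorem split_of_tangent {d : ℕ} {o : V4 → V4 →ₗ[ℂ] ℂ} (hol : ∀ v, Hg (d + 1) (fun z => o z v))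
    (rad : ∀ z, o z z = 0) (dim : dimH {z | ∀ v, o z v = 0} < 6)
    (free : ∀ q : V4, q ≠ 0 → ∃ X Y : V4 → V4, AnalyticAt ℂ X q ∧ AnalyticAt ℂ Y q ∧
      ∀ᶠ z in 𝓝 q, ∀ v, o z v = d4 (X z) (Y z) z v)
    (int : ∀ z a b c, o z a * Gd o z b c + o z b * Gd o z c a + o z c * Gd o z a b = 0)
    (S : V4 →ₗ[ℂ] V4) (hS : ∀ c : ℂ, S ≠ c • LinearMap.id) (tan : ∀ z, o z (S z) = 0) : Spl o := by
  have hN : ∀ b, Hg (d + 1) (fun z => Gd o z (S z) b) := by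
    intro b
    have e : (fun z => Gd o z (S z) b) = fun z => S z 0 * Gd o z (ee 0) b + S z 1 * Gd o z (ee 1) b
      + S z 2 * Gd o z (ee 2) b + S z 3 * Gd o z (ee 3) b := by
      funext z; exact Gd_left hol z (S z) b
    rw [e]
    have l : ∀ i, Hg (d + 1) (fun z => S z i * Gd o z (ee i) b) := fun i =>
      (Gd_hg hol (ee i) b).lmul ((pr i) ∘ₗ S)
    exact (((l 0).add (l 1)).add (l 2)).add (l 3)
  obtain ⟨f, hf, hfe⟩ := hartogs_div (fun v z => o z v) (fun b z => Gd o z (S z) b) 0 univ univ_mem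
    (fun v => (hol v).an) dim (fun b => (hN b).an) (by
      intro z _ b c
      have h1 := int z (S z) b c
      rw [tan, Gd_swap z c (S z)] at h1
      linear_combination h1)
  have hc : ∀ z b, Gd o z (S z) b = f 0 * o z b := by
    intro z b
    have hl : Tendsto (fun t : ℂ => t • z) (𝓝 0) (𝓝 0) := by
      have : Continuous (fun t : ℂ => t • z) := by fun_prop
      simpa using this.tendsto 0
    have := eq_of_ne_zero (f := fun _ : ℂ => Gd o z (S z) b) (g := fun t : ℂ => f (t • z) * o z b)
      continuousAt_const
      ((ContinuousAt.comp_of_eq hf.continuousAt (by fun_prop) (by simp)).mul continuousAt_const) (by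
        filter_upwards [self_mem_nhdsWithin, (hl.eventually hfe).filter_mono nhdsWithin_le_nhds] with t ht h4
        have h5 := h4 b
        have h6 := (hN b).hom t z
        have h7 := (hol b).hom t z
        rw [h6, h7] at h5
        apply mul_left_cancel₀ (pow_ne_zero (d + 1) ht)
        linear_combination h5)
    simpa using this
  let T : V4 →ₗ[ℂ] V4 := S - (f 0 / ((d : ℂ) + 2)) • LinearMap.id
  have hT : Su d o T := by
    refine ⟨hol, rad, dim, free, fun z b => ?_⟩
    have e : T z = S z + (-(f 0 / ((d : ℂ) + 2))) • z := by simp [T, sub_eq_add_neg]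
    rw [e, Gd_add hol, Gd_smul hol, Gd_euler hol rad, hc]
    have := two_ne d
    field_simp
    ring
  refine hT.split fun h0 => hS _ (sub_eq_zero.1 h0)


/-- The form as a family of linear functionals. -/
noncomputable def oF (w : V4 → AlternatingMap ℂ V4 ℂ (Fin 1)) (z : V4) : V4 →ₗ[ℂ] ℂ :=
  (AlternatingMap.ofSubsingleton ℂ V4 ℂ (0 : Fin 1)).symm (w z)

theorem oF_apply (w : V4 → AlternatingMap ℂ V4 ℂ (Fin 1)) (z v : V4) : oF w z v = w z ![v] := by
  have : (fun _ : Fin 1 => v) = ![v] := by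
    ext i; simp
  simp [oF, this]

theorem alt_four (Θ : AlternatingMap ℂ V4 ℂ (Fin 4)) (p q r s : V4) :
    Θ ![p, q, r, s] = Θ ee * d4 p q r s := by
  have h := AlternatingMap.eq_smul_basis_det (Pi.basisFun ℂ (Fin 4)) Θ
  have h1 := congrArg (fun f => f ![p, q, r, s]) h
  simp only [AlternatingMap.smul_apply, smul_eq_mul] at h1
  rw [h1, Pi.basisFun_det_apply, d4_eq_det]
  congr 2
  ext i
  simp

/-- Theorem C: A codimension one singular holomorphic foliation on `ℙ³`
(i.e. an integrable two-dimensional distribution), with locally free tangent sheaf and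
tangent to a nontrivial global holomorphic vector field on `ℙ³` (represented by a linear
endomorphism of `ℂ⁴` which is not a scalar multiple of the identity), has split tangent
sheaf. -/
theorem statement_2 (F : ProjDist 3 2) (hint : Integrable1 F.ω) (hfree : PLocFree F)
    (hvf : ∃ S : Module.End ℂ (Cn 4), (∀ c : ℂ, S ≠ c • LinearMap.id) ∧
      ∀ (z : Cn 4) (v : Fin (3 - 2) → Cn 4) (i : Fin (3 - 2)), v i = S z → F.ω z v = 0) :
    PSplits (by omega) F := by
  obtain ⟨S, hS, hSt⟩ := hvf
  have hv1 : ∀ v : Fin 1 → V4, v = ![v 0] := fun v => by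
    ext i; fin_cases i; rfl
  have hspl : Spl (oF F.ω) := by
    refine split_of_tangent (d := F.d) (S := S) ?_ ?_ ?_ ?_ ?_ hS ?_
    · intro v
      refine ⟨?_, ?_⟩
      · simp only [oF_apply]
        exact F.hol ![v]
      · intro t z
        simp only [oF_apply]
        exact F.homog t z ![v]
    · intro z
      rw [oF_apply]
      exact F.radial z ![z] 0 rfl
    · have hsub : {z | ∀ v, oF F.ω z v = 0} ⊆ {z | z ≠ 0 ∧ F.ω z = 0} ∪ {0} := by
        intro z hz
        by_cases h0 : z = 0
        · right; exact h0
        · left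
          refine ⟨h0, ?_⟩
          ext v
          have := hz (v 0)
          rw [oF_apply] at this
          change F.ω z v = 0
          rw [hv1 v]
          exact this
      refine (dimH_mono hsub).trans_lt ?_
      rw [dimH_union, dimH_singleton]
      refine max_lt ?_ (by norm_num)
      rcases F.codim with h | h
      · have h' : {z : V4 | z ≠ 0 ∧ F.ω z = 0} = ∅ := h
        rw [h', dimH_empty]; norm_num
      · have h' : dimH {z : V4 | z ≠ 0 ∧ F.ω z = 0} + 2 * ((2 : ℕ) : ℝ≥0∞) ≤ 2 * ((4 : ℕ) : ℝ≥0∞) := h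
        by_contra hc
        push Not at hc
        have h2 := (add_le_add_left hc (2 * ((2 : ℕ) : ℝ≥0∞))).trans h'
        norm_num at h2
    · intro q hq
      obtain ⟨X, Y, Θ, hX, hY, hΘ, he⟩ := hfree q hq
      refine ⟨fun z => (Θ z ee) • X z, Y, (hΘ ee).smul hX, hY, ?_⟩
      filter_upwards [he] with z hz v
      rw [oF_apply, smul_d4]
      exact (hz ![v]).trans (alt_four (Θ z) (X z) (Y z) z v)
    · intro z a b c
      have := hint z a b c
      simp only [oF_apply, Gd]
      exact this
    · intro z
      rw [oF_apply]
      exact hSt z ![S z] 0 rfl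
  obtain ⟨X1, X2, d1, d2, a1, a2, h1, h2, h⟩ := hspl
  refine ⟨X1, X2, d1, d2, 1, one_ne_zero, a1, a2, h1, h2, ?_⟩
  intro z v
  rw [one_mul, hv1 v]
  refine (oF_apply F.ω z (v 0)).symm.trans ((h z (v 0)).trans ?_)
  symm
  exact d4_eq_det _
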